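/- arXiv:2405.17415 — 2 statements merged into one kernel-verified Lean document; each statement's English description precedes it below -/
import Mathlib

section
/- Let D be a two-dimensional singular holomorphic distribution on ℙ^n, n ≥ 3, and let G be a one-dimensional foliation on ℙ^n tangent to D. If codim(sing(G)) ≥ 3, then G locally divides D at every point; in particular, the tangent sheaf T_D splits as a direct sum of two line bundles. -/
open Topology Filter Set
open scoped ENNReal Manifold

noncomputable section

/-- `ℂⁿ`. -/
abbrev Cn (n : ℕ) : Type := Fin n → ℂ

/-- Holomorphic `m`-forms on (open subsets of) `ℂⁿ`, as alternating-map valued functions. -/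
abbrev Form (n m : ℕ) : Type := Cn n → AlternatingMap ℂ (Cn n) ℂ (Fin m)

/-- Vector fields on (open subsets of) `ℂⁿ`. -/
abbrev VF (n : ℕ) : Type := Cn n → Cn n

/-- A form is holomorphic on `U` if all its coefficient functions are. -/
def HolFormOn {n m : ℕ} (U : Set (Cn n)) (ω : Form n m) : Prop :=
  ∀ v : Fin m → Cn n, AnalyticOnNhd ℂ (fun z => ω z v) U

/-- A form is holomorphic at (a neighborhood of) a point `c`. -/
def HolFormAt {n m : ℕ} (c : Cn n) (ω : Form n m) : Prop :=
  ∀ v : Fin m → Cn n, AnalyticAt ℂ (fun z => ω z v) c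

/-- The zero locus (singular set) of a form. -/
def zeroLocus {n m : ℕ} (ω : Form n m) : Set (Cn n) := {z | ω z = 0}

/-- `V ⊆ ℂⁿ` has (complex) codimension at least `c`; via Hausdorff dimension
(a complex-analytic set of complex dimension `d` has Hausdorff dimension `2d`).
The empty set has codimension `≥ c` for every `c`. -/
def CodimGE (n : ℕ) (V : Set (Cn n)) (c : ℕ) : Prop :=
  V = ∅ ∨ dimH V + 2 * (c : ℝ≥0∞) ≤ 2 * (n : ℝ≥0∞)

/-- The germ of `V` at `c` has codimension at least `k`. -/
def GermCodimGE (n : ℕ) (c : Cn n) (V : Set (Cn n)) (k : ℕ) : Prop :=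
  ∃ U ∈ 𝓝 c, CodimGE n (V ∩ U) k

/-- `i_X (ω) = 0` at the point `z` : the form `ω` annihilates the vector `X z` at `z`. -/
def TangentAt {n m : ℕ} (ω : Form n m) (X : VF n) (z : Cn n) : Prop :=
  ∀ (v : Fin m → Cn n) (i : Fin m), v i = X z → ω z v = 0

/-- `ω` is locally decomposable (as a wedge of holomorphic `1`-forms) at the points
of `U` where it does not vanish. -/
def LocallyDecomp {n m : ℕ} (U : Set (Cn n)) (ω : Form n m) : Prop :=
  ∀ z ∈ U, ω z ≠ 0 → ∃ W ∈ 𝓝 z, W ⊆ U ∧ ∃ η : Fin m → Cn n → (Cn n →ₗ[ℂ] ℂ),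
    (∀ i (v : Cn n), AnalyticOnNhd ℂ (fun w => η i w v) W) ∧
    ∀ w ∈ W, ∀ v : Fin m → Cn n, ω w v = Matrix.det (Matrix.of fun i j => η i w (v j))

/-- The rank of the derivative (linear part) of a vector field at a point. -/
def rkAt {n : ℕ} (X : VF n) (z : Cn n) : ℕ :=
  Module.finrank ℂ (LinearMap.range (fderiv ℂ X z).toLinearMap)

/-- The germ at `c` of the vector field `X` divides the germ of the `m`-form `ω`:
`ω = i_X Θ` for some germ of holomorphic `(m+1)`-form `Θ`. -/
def DividesAt {n m : ℕ} (X : VF n) (ω : Form n m) (c : Cn n) : Prop :=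
  ∃ Θ : Form n (m + 1), HolFormAt c Θ ∧
    ∀ᶠ z in 𝓝 c, ∀ v : Fin m → Cn n, ω z v = Θ z (Fin.cons (X z) v)

/-- The germ at `0` of an `m`-form defines a singular holomorphic distribution:
it is holomorphic, locally decomposable outside its zero set, and its zero set has
codimension at least two. -/
structure IsGermDist (n m : ℕ) (ω : Form n m) : Prop where
  hol : ∃ U ∈ 𝓝 (0 : Cn n), HolFormOn U ω ∧ LocallyDecomp U ω
  codim : GermCodimGE n 0 (zeroLocus ω) 2

/-- The tangent sheaf of the germ of two-dimensional distribution defined by the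
`m`-form `ω` (`m = n - 2`) is locally free: `ω = i_Y i_Z Θ` for germs of vector fields
`Y, Z` and a germ of `n`-form `Θ`. -/
def GermLocFree2 (n m : ℕ) (ω : Form n m) : Prop :=
  ∃ (Y Z : VF n) (Θ : Form n (m + 2)), AnalyticAt ℂ Y 0 ∧ AnalyticAt ℂ Z 0 ∧ HolFormAt 0 Θ ∧
    ∀ᶠ z in 𝓝 (0 : Cn n), ∀ v : Fin m → Cn n,
      ω z v = Θ z (Fin.cons (Y z) (Fin.cons (Z z) v))

/-- `ω = i_X i_Y Θ` near `0`, for some germ of vector field `Y` and germ of `n`-form `Θ`. -/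
def DivPairAt {n m : ℕ} (X : VF n) (ω : Form n m) : Prop :=
  ∃ (Y : VF n) (Θ : Form n (m + 2)), AnalyticAt ℂ Y 0 ∧ HolFormAt 0 Θ ∧
    ∀ᶠ z in 𝓝 (0 : Cn n), ∀ v : Fin m → Cn n,
      ω z v = Θ z (Fin.cons (X z) (Fin.cons (Y z) v))

/-- The tangent sheaf of the germ of `k`-dimensional distribution defined by the `m`-form
`ω` (`n = k + m`) is locally free: `ω = i_{X_1} ⋯ i_{X_k} Θ`. -/
def GermLocFreeK (n k m : ℕ) (h : n = k + m) (ω : Form n m) : Prop :=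
  ∃ (Xs : Fin k → VF n) (Θ : Form n n), (∀ i, AnalyticAt ℂ (Xs i) 0) ∧ HolFormAt 0 Θ ∧
    ∀ᶠ z in 𝓝 (0 : Cn n), ∀ v : Fin m → Cn n,
      ω z v = Θ z (fun i => Fin.append (fun a => Xs a z) v (Fin.cast h i))

/-- The germs at `c` of the vector fields `Xs` freely generate the germs of vector
fields tangent to the distribution defined by `ω` : every germ of tangent vector field
is a combination of the `Xs` with holomorphic coefficients, and the coefficients in such
combinations are unique (i.e. the `Xs` are independent over the local ring at `c`). -/
def FreeGensAt {n m : ℕ} (ω : Form n m) {k : ℕ} (Xs : Fin k → VF n) (c : Cn n) : Prop :=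
  (∀ Z : VF n, AnalyticAt ℂ Z c → (∀ᶠ z in 𝓝 c, TangentAt ω Z z) →
      ∃ f : Fin k → Cn n → ℂ, (∀ i, AnalyticAt ℂ (f i) c) ∧
        ∀ᶠ z in 𝓝 c, Z z = ∑ i, f i z • Xs i z) ∧
  (∀ f : Fin k → Cn n → ℂ, (∀ i, AnalyticAt ℂ (f i) c) →
      (∀ᶠ z in 𝓝 c, (∑ i, f i z • Xs i z) = 0) → ∀ i, ∀ᶠ z in 𝓝 c, f i z = 0)

/-- Polydiscs in `ℂⁿ`. -/
def IsPolydisc {n : ℕ} (U : Set (Cn n)) : Prop :=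
  ∃ (c : Cn n) (r : Fin n → ℝ), (∀ i, 0 < r i) ∧ U = {z | ∀ i, dist (z i) (c i) < r i}

/-- The wedge product of a `1`-form with a `k`-form, as a function of `k+1` vectors. -/
def wedge1 {n k : ℕ} (ω : Form n 1) (α : Form n k) (z : Cn n) (v : Fin (k + 1) → Cn n) : ℂ :=
  ∑ i : Fin (k + 1), (-1 : ℂ) ^ (i : ℕ) * ω z (fun _ => v i) * α z (fun j => v (i.succAbove j))

/-! ### Analytic subsets of open sets of `ℂᴺ`, irreducibility, components -/

/-- `V` is an analytic subset of `U`: locally (on `U`) it is the common zero set of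
finitely many holomorphic functions. -/
def IsAnalyticIn {N : ℕ} (U V : Set (Cn N)) : Prop :=
  V ⊆ U ∧ ∀ p ∈ U, ∃ W ∈ 𝓝 p, ∃ (r : ℕ) (f : Fin r → Cn N → ℂ),
    (∀ i, AnalyticOnNhd ℂ (f i) W) ∧ ∀ z ∈ W ∩ U, (z ∈ V ↔ ∀ i, f i z = 0)

/-- An irreducible analytic subset of `U`. -/
def IsIrredAnalyticIn {N : ℕ} (U V : Set (Cn N)) : Prop :=
  IsAnalyticIn U V ∧ V.Nonempty ∧
    ∀ V1 V2, IsAnalyticIn U V1 → IsAnalyticIn U V2 → V = V1 ∪ V2 → V = V1 ∨ V = V2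

/-- `C` is an irreducible component of the analytic set `V ⊆ U` : a maximal irreducible
analytic subset of `U` contained in `V`. -/
def IsIrredComponentIn {N : ℕ} (U V C : Set (Cn N)) : Prop :=
  IsIrredAnalyticIn U C ∧ C ⊆ V ∧ ∀ C', IsIrredAnalyticIn U C' → C ⊆ C' → C' ⊆ V → C' = C

/-! ### Distributions and foliations on `ℙⁿ`, in homogeneous coordinates -/

/-- A `k`-dimensional singular holomorphic distribution of degree `d` on `ℙⁿ`, given in
homogeneous coordinates by a homogeneous `(n-k)`-form `ω` on `ℂⁿ⁺¹` (with polynomial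
coefficients of degree `d+1`) satisfying `i_R ω = 0`, locally decomposable outside its
singular set, whose singular set has codimension at least `2`. -/
structure ProjDist (n k : ℕ) where
  d : ℕ
  ω : Form (n + 1) (n - k)
  hol : HolFormOn Set.univ ω
  homog : ∀ (t : ℂ) (z : Cn (n + 1)) (v : Fin (n - k) → Cn (n + 1)),
    ω (t • z) v = t ^ (d + 1) * ω z v
  radial : ∀ (z : Cn (n + 1)) (v : Fin (n - k) → Cn (n + 1)) (i : Fin (n - k)),
    v i = z → ω z v = 0
  decomp : LocallyDecomp Set.univ ω
  codim : CodimGE (n + 1) {z | z ≠ 0 ∧ ω z = 0} 2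

/-- The singular set of a distribution on `ℙⁿ`, as a cone in `ℂⁿ⁺¹ \ {0}`. -/
def ProjDist.coneSing {n k : ℕ} (D : ProjDist n k) : Set (Cn (n + 1)) :=
  {z | z ≠ 0 ∧ D.ω z = 0}

/-- A one-dimensional singular holomorphic foliation of degree `d` on `ℙⁿ`, given in
homogeneous coordinates by a homogeneous polynomial vector field on `ℂⁿ⁺¹`, whose
singular set (points where `V ∧ R = 0`) has codimension at least `2`. -/
structure ProjFol1 (n : ℕ) where
  d : ℕ
  V : VF (n + 1)
  hol : AnalyticOnNhd ℂ V Set.univ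
  homog : ∀ (t : ℂ) (z : Cn (n + 1)), V (t • z) = t ^ d • V z
  codim : CodimGE (n + 1) {z | z ≠ 0 ∧ V z ∈ Submodule.span ℂ {z}} 2

/-- The singular set of a one-dimensional foliation on `ℙⁿ`, as a cone in `ℂⁿ⁺¹ \ {0}`. -/
def ProjFol1.coneSing {n : ℕ} (G : ProjFol1 n) : Set (Cn (n + 1)) :=
  {z | z ≠ 0 ∧ G.V z ∈ Submodule.span ℂ {z}}

/-- The foliation `G` is tangent to the distribution `D` : `i_V ω = 0`. -/
def PTangent {n k : ℕ} (G : ProjFol1 n) (D : ProjDist n k) : Prop :=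
  ∀ (z : Cn (n + 1)) (v : Fin (n - k) → Cn (n + 1)) (i : Fin (n - k)),
    v i = G.V z → D.ω z v = 0

/-- `G` locally divides the two-dimensional distribution `D` at the point of `ℙⁿ`
corresponding to `q ∈ ℂⁿ⁺¹ \ {0}` : in homogeneous coordinates, `ω = i_V i_R Θ` near `q`
for some germ of holomorphic `(n-1)`-form `Θ` (equivalently, in an affine chart at `[q]`,
the defining vector field of `G` divides the defining form of `D`). -/
def PLocDividesAt {n : ℕ} (G : ProjFol1 n) (D : ProjDist n 2) (q : Cn (n + 1)) : Prop :=
  ∃ Θ : Form (n + 1) (n - 2 + 2), HolFormAt q Θ ∧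
    ∀ᶠ z in 𝓝 q, ∀ v : Fin (n - 2) → Cn (n + 1),
      D.ω z v = Θ z (Fin.cons (G.V z) (Fin.cons z v))

/-- The tangent sheaf of the two-dimensional distribution `D` on `ℙⁿ` is locally free:
near every point of `ℂⁿ⁺¹ \ {0}` one can write `ω = i_X i_Y i_R Θ`. -/
def PLocFreeAt {n : ℕ} (D : ProjDist n 2) (q : Cn (n + 1)) : Prop :=
  ∃ (X Y : VF (n + 1)) (Θ : Form (n + 1) (n - 2 + 3)),
    AnalyticAt ℂ X q ∧ AnalyticAt ℂ Y q ∧ HolFormAt q Θ ∧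
    ∀ᶠ z in 𝓝 q, ∀ v : Fin (n - 2) → Cn (n + 1),
      D.ω z v = Θ z (Fin.cons (X z) (Fin.cons (Y z) (Fin.cons z v)))

def PLocFree {n : ℕ} (D : ProjDist n 2) : Prop :=
  ∀ q : Cn (n + 1), q ≠ 0 → PLocFreeAt D q

/-- The linearization, at a singular point `q` (with `ℓ q = 1`), of the vector field
induced on the affine chart `{ℓ = 1}` of `ℙⁿ` by the homogeneous vector field `V`. -/
def projLin {n : ℕ} (V : VF n) (q : Cn n) (ℓ : Cn n →ₗ[ℂ] ℂ) : Cn n →ₗ[ℂ] Cn n :=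
  (fderiv ℂ V q).toLinearMap - LinearMap.smulRight (ℓ ∘ₗ (fderiv ℂ V q).toLinearMap) q
    - ℓ (V q) • LinearMap.id

/-- The linear rank of the one-dimensional foliation `G` on `ℙⁿ` is at least `r` :
at every singular point, the linearization of the vector field induced on an affine
chart has rank at least `r`. -/
def PLinRankGE {n : ℕ} (G : ProjFol1 n) (r : ℕ) : Prop :=
  ∀ q ∈ G.coneSing, ∃ ℓ : Cn (n + 1) →ₗ[ℂ] ℂ, ℓ q = 1 ∧
    r ≤ Module.finrank ℂ (Submodule.map (projLin G.V q ℓ) (LinearMap.ker ℓ))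

/-- `T_D = T_G ⊕ T_H` : in homogeneous coordinates,
`ω = c ⋅ i_{V_G} i_{V_H} i_R (dx_0 ∧ ⋯ ∧ dx_n)` for a nonzero constant `c`. -/
def SplitPair {n : ℕ} (hn : n + 1 = 3 + (n - 2)) (G H : ProjFol1 n) (D : ProjDist n 2) :
    Prop :=
  ∃ c : ℂ, c ≠ 0 ∧ ∀ (z : Cn (n + 1)) (v : Fin (n - 2) → Cn (n + 1)),
    D.ω z v = c * Matrix.det (Matrix.of fun i j =>
      Fin.append ![G.V z, H.V z, z] v (Fin.cast hn i) j)

/-- The tangent sheaf of the two-dimensional distribution `D` on `ℙⁿ` splits as a direct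
sum of two line bundles: `ω = c ⋅ i_{X_1} i_{X_2} i_R (dx_0 ∧ ⋯ ∧ dx_n)` for homogeneous
polynomial vector fields `X_1, X_2` on `ℂⁿ⁺¹`. -/
def PSplits {n : ℕ} (hn : n + 1 = 3 + (n - 2)) (D : ProjDist n 2) : Prop :=
  ∃ (X1 X2 : VF (n + 1)) (d1 d2 : ℕ) (c : ℂ), c ≠ 0 ∧
    AnalyticOnNhd ℂ X1 Set.univ ∧ AnalyticOnNhd ℂ X2 Set.univ ∧
    (∀ (t : ℂ) (z : Cn (n + 1)), X1 (t • z) = t ^ d1 • X1 z) ∧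
    (∀ (t : ℂ) (z : Cn (n + 1)), X2 (t • z) = t ^ d2 • X2 z) ∧
    ∀ (z : Cn (n + 1)) (v : Fin (n - 2) → Cn (n + 1)),
      D.ω z v = c * Matrix.det (Matrix.of fun i j =>
        Fin.append ![X1 z, X2 z, z] v (Fin.cast hn i) j)

/-- The coefficient of the exterior differential of a `1`-form: `dω(a,b)` at `z`. -/
def extd1 {N : ℕ} (ω : Form N 1) (z a b : Cn N) : ℂ :=
  fderiv ℂ (fun y => ω y ![b]) z a - fderiv ℂ (fun y => ω y ![a]) z b

/-- The Frobenius integrability condition `ω ∧ dω = 0` for a `1`-form. -/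
def Integrable1 {N : ℕ} (ω : Form N 1) : Prop :=
  ∀ z a b c : Cn N,
    ω z ![a] * extd1 ω z b c + ω z ![b] * extd1 ω z c a + ω z ![c] * extd1 ω z a b = 0

/-! ### Distributions and foliations on complex manifolds -/

section Manifold

variable {n k : ℕ} {M : Type*} [TopologicalSpace M] [ChartedSpace (Cn n) M]

/-- A `k`-dimensional singular holomorphic distribution on a complex `n`-manifold `M`:
around each point it is given, in the chart at that point, by a holomorphic `(n-k)`-form,
locally decomposable outside its zero set, with zero set of codimension at least 2;
on overlaps the local forms agree up to a nonvanishing holomorphic factor. -/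
structure MDist (n k : ℕ) (M : Type*) [TopologicalSpace M] [ChartedSpace (Cn n) M] where
  ω : M → Form n (n - k)
  dom : M → Set (Cn n)
  dom_open : ∀ p, IsOpen (dom p)
  dom_sub : ∀ p, dom p ⊆ (chartAt (Cn n) p).target
  dom_mem : ∀ p, chartAt (Cn n) p p ∈ dom p
  hol : ∀ p, HolFormOn (dom p) (ω p)
  decomp : ∀ p, LocallyDecomp (dom p) (ω p)
  codim : ∀ p, CodimGE n (zeroLocus (ω p) ∩ dom p) 2
  compat : ∀ p q : M, ∀ x : M, x ∈ (chartAt (Cn n) p).source → x ∈ (chartAt (Cn n) q).source →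
    chartAt (Cn n) p x ∈ dom p → chartAt (Cn n) q x ∈ dom q →
    ∃ W ∈ 𝓝 (chartAt (Cn n) p x), W ⊆ dom p ∧
      ∃ h : Cn n → ℂ, AnalyticOnNhd ℂ h W ∧ (∀ z ∈ W, h z ≠ 0) ∧
      ∀ z ∈ W, ∀ v : Fin (n - k) → Cn n,
        ω p z v = h z * ω q ((chartAt (Cn n) q) ((chartAt (Cn n) p).symm z))
          (fun i => fderiv ℂ (fun y => (chartAt (Cn n) q) ((chartAt (Cn n) p).symm y)) z (v i))

/-- The singular set of a distribution on a manifold. -/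
def MDist.sing (D : MDist n k M) : Set M :=
  {x | D.ω x (chartAt (Cn n) x x) = 0}

/-- A one-dimensional singular holomorphic foliation on a complex `n`-manifold `M`:
around each point it is given, in the chart at that point, by a holomorphic vector field
with singular set of codimension at least 2; on overlaps the local vector fields agree,
up to a nonvanishing holomorphic factor, under the differentials of the transition maps. -/
structure MFol1 (n : ℕ) (M : Type*) [TopologicalSpace M] [ChartedSpace (Cn n) M] where
  V : M → VF n
  dom : M → Set (Cn n)
  dom_open : ∀ p, IsOpen (dom p)
  dom_sub : ∀ p, dom p ⊆ (chartAt (Cn n) p).target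
  dom_mem : ∀ p, chartAt (Cn n) p p ∈ dom p
  hol : ∀ p, AnalyticOnNhd ℂ (V p) (dom p)
  codim : ∀ p, CodimGE n ({z ∈ dom p | V p z = 0}) 2
  compat : ∀ p q : M, ∀ x : M, x ∈ (chartAt (Cn n) p).source → x ∈ (chartAt (Cn n) q).source →
    chartAt (Cn n) p x ∈ dom p → chartAt (Cn n) q x ∈ dom q →
    ∃ W ∈ 𝓝 (chartAt (Cn n) p x), W ⊆ dom p ∧
      ∃ h : Cn n → ℂ, AnalyticOnNhd ℂ h W ∧ (∀ z ∈ W, h z ≠ 0) ∧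
      ∀ z ∈ W,
        fderiv ℂ (fun y => (chartAt (Cn n) q) ((chartAt (Cn n) p).symm y)) z (V p z)
          = h z • V q ((chartAt (Cn n) q) ((chartAt (Cn n) p).symm z))

/-- The singular set of a one-dimensional foliation on a manifold. -/
def MFol1.sing (G : MFol1 n M) : Set M :=
  {x | G.V x (chartAt (Cn n) x x) = 0}

/-- The foliation `G` is tangent to the distribution `D`. -/
def MTangent (G : MFol1 n M) (D : MDist n k M) : Prop :=
  ∀ p : M, ∀ z ∈ G.dom p ∩ D.dom p, TangentAt (D.ω p) (G.V p) z

/-- `G` locally divides `D` at `p` : in the chart at `p`, the germ of the defining vector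
field of `G` divides the germ of the defining form of `D`. -/
def MLocDividesAt (G : MFol1 n M) (D : MDist n k M) (p : M) : Prop :=
  DividesAt (G.V p) (D.ω p) (chartAt (Cn n) p p)

/-- The linear rank of `G` is at least `r`: at every singular point `p`, the rank of the
derivative at (the chart image of) `p` of the defining vector field is at least `r`. -/
def MLinRankGE (G : MFol1 n M) (r : ℕ) : Prop :=
  ∀ p ∈ MFol1.sing G, r ≤ rkAt (G.V p) (chartAt (Cn n) p p)

/-- The stalk of the tangent sheaf of `D` at `p` is a free module with `r` generators. -/
def MStalkFreeWith (D : MDist n k M) (p : M) (r : ℕ) : Prop :=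
  ∃ Xs : Fin r → VF n, (∀ i, AnalyticAt ℂ (Xs i) (chartAt (Cn n) p p)) ∧
    (∀ i, ∀ᶠ z in 𝓝 (chartAt (Cn n) p p), TangentAt (D.ω p) (Xs i) z) ∧
    FreeGensAt (D.ω p) Xs (chartAt (Cn n) p p)

/-- (a) The tangent sheaf of `D` is locally free of rank `k`: near every point there are
`k` holomorphic tangent vector fields which freely generate every stalk. -/
def MPropA (D : MDist n k M) : Prop :=
  ∀ p : M, ∃ U : Set (Cn n), IsOpen U ∧ chartAt (Cn n) p p ∈ U ∧ U ⊆ D.dom p ∧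
    ∃ Xs : Fin k → VF n, (∀ i, AnalyticOnNhd ℂ (Xs i) U) ∧
      (∀ i, ∀ z ∈ U, TangentAt (D.ω p) (Xs i) z) ∧
      ∀ z ∈ U, FreeGensAt (D.ω p) Xs z

/-- (b) Near every point, `T_D` is the direct sum of the tangent sheaves of `k`
one-dimensional foliations (defined by vector fields with singular set of codim `≥ 2`). -/
def MPropB (D : MDist n k M) : Prop :=
  ∀ p : M, ∃ U : Set (Cn n), IsOpen U ∧ chartAt (Cn n) p p ∈ U ∧ U ⊆ D.dom p ∧
    ∃ Xs : Fin k → VF n, (∀ i, AnalyticOnNhd ℂ (Xs i) U) ∧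
      (∀ i, CodimGE n {z ∈ U | Xs i z = 0} 2) ∧
      (∀ i, ∀ z ∈ U, TangentAt (D.ω p) (Xs i) z) ∧
      ∀ z ∈ U, FreeGensAt (D.ω p) Xs z

/-- (c) Near every point, a form `i_{X_1} ⋯ i_{X_k} Θ` defines `D`. -/
def MPropC (h : n = k + (n - k)) (D : MDist n k M) : Prop :=
  ∀ p : M, ∃ U : Set (Cn n), IsOpen U ∧ chartAt (Cn n) p p ∈ U ∧ U ⊆ D.dom p ∧
    ∃ (Xs : Fin k → VF n) (Θ : Form n n) (u : Cn n → ℂ),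
      (∀ i, AnalyticOnNhd ℂ (Xs i) U) ∧ HolFormOn U Θ ∧
      AnalyticOnNhd ℂ u U ∧ (∀ z ∈ U, u z ≠ 0) ∧
      ∀ z ∈ U, ∀ v : Fin (n - k) → Cn n,
        D.ω p z v = u z * Θ z (fun i => Fin.append (fun a => Xs a z) v (Fin.cast h i))

/-- (d) At every point, a form `i_{X_1} ⋯ i_{X_k} Θ` defines the germ of `D`. -/
def MPropD (h : n = k + (n - k)) (D : MDist n k M) : Prop :=
  ∀ p : M, ∃ (Xs : Fin k → VF n) (Θ : Form n n) (u : Cn n → ℂ),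
    (∀ i, AnalyticAt ℂ (Xs i) (chartAt (Cn n) p p)) ∧ HolFormAt (chartAt (Cn n) p p) Θ ∧
    AnalyticAt ℂ u (chartAt (Cn n) p p) ∧ u (chartAt (Cn n) p p) ≠ 0 ∧
    ∀ᶠ z in 𝓝 (chartAt (Cn n) p p), ∀ v : Fin (n - k) → Cn n,
      D.ω p z v = u z * Θ z (fun i => Fin.append (fun a => Xs a z) v (Fin.cast h i))

/-- (e) Every stalk of `T_D` is a free module with `k` generators. -/
def MPropE (D : MDist n k M) : Prop :=
  ∀ p : M, MStalkFreeWith D p k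

/-- A subset `S` of the complex manifold `M` is analytic: it is closed and locally,
in charts, the common zero set of finitely many holomorphic functions. -/
def MIsAnalytic (n : ℕ) {M : Type*} [TopologicalSpace M] [ChartedSpace (Cn n) M] (S : Set M) : Prop :=
  IsClosed S ∧ ∀ p : M, ∃ W ∈ 𝓝 (chartAt (Cn n) p p), ∃ (r : ℕ) (f : Fin r → Cn n → ℂ),
    (∀ i, AnalyticOnNhd ℂ (f i) W) ∧
    ∀ z ∈ W ∩ (chartAt (Cn n) p).target, ((chartAt (Cn n) p).symm z ∈ S ↔ ∀ i, f i z = 0)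

/-- Irreducible analytic subsets of `M`. -/
def MIrredAnalytic (n : ℕ) {M : Type*} [TopologicalSpace M] [ChartedSpace (Cn n) M] (S : Set M) : Prop :=
  MIsAnalytic n S ∧ S.Nonempty ∧
    ∀ S1 S2 : Set M, MIsAnalytic n S1 → MIsAnalytic n S2 → S = S1 ∪ S2 → S = S1 ∨ S = S2

/-- `C` is an irreducible component of `V ⊆ M`. -/
def MIrredComponentOf (n : ℕ) {M : Type*} [TopologicalSpace M] [ChartedSpace (Cn n) M] (V C : Set M) : Prop :=
  MIrredAnalytic n C ∧ C ⊆ V ∧ ∀ C', MIrredAnalytic n C' → C ⊆ C' → C' ⊆ V → C' = C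

/-- The local dimension of `S ⊆ M` at `p` equals `d` (via Hausdorff dimension of chart
images on small neighborhoods). -/
def MLocDimEq (n : ℕ) {M : Type*} [TopologicalSpace M] [ChartedSpace (Cn n) M] (S : Set M) (p : M) (d : ℕ) : Prop :=
  ∀ᶠ U in (𝓝 p).smallSets,
    dimH (chartAt (Cn n) p '' (S ∩ U ∩ (chartAt (Cn n) p).source)) = ((2 * d : ℕ) : ℝ≥0∞)

/-- The dimension of `S ⊆ M` equals `d`. -/
def MDimEq (n : ℕ) {M : Type*} [TopologicalSpace M] [ChartedSpace (Cn n) M] (S : Set M) (d : ℕ) : Prop :=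
  (∀ p : M, ∀ᶠ U in (𝓝 p).smallSets,
    dimH (chartAt (Cn n) p '' (S ∩ U ∩ (chartAt (Cn n) p).source)) ≤ ((2 * d : ℕ) : ℝ≥0∞)) ∧
  ∃ p : M, MLocDimEq n S p d

end Manifold

end

namespace NagataAux

open Polynomial MvPolynomial Ideal Nat RingHom List

variable {k : Type*} [Field k] {n : ℕ} (f : MvPolynomial (Fin (n + 1)) k)
variable (v w : Fin (n + 1) →₀ ℕ)

/-- The algebra map sending `X_i` to `X_i + c X_0 ^ (up ^ i)` for `i ≠ 0` and fixing `X_0`. -/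
noncomputable abbrev T1 (c : k) :
    MvPolynomial (Fin (n + 1)) k →ₐ[k] MvPolynomial (Fin (n + 1)) k :=
  aeval fun i ↦ if i = 0 then X 0 else X i + c • X 0 ^ ((2 + f.totalDegree) ^ i.1)

lemma t1_comp_t1_neg (c : k) : (T1 f c).comp (T1 f (-c)) = AlgHom.id _ _ := by
  rw [comp_aeval, ← MvPolynomial.aeval_X_left]
  ext i v
  cases i using Fin.cases <;> simp

/-- The corresponding automorphism. -/
noncomputable abbrev T := AlgEquiv.ofAlgHom (T1 f 1) (T1 f (-1))
  (t1_comp_t1_neg f 1) (by simpa using t1_comp_t1_neg f (-1))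

variable {f v} in
lemma lt_up (vlt : ∀ i, v i < 2 + f.totalDegree) : ∀ l ∈ ofFn v, l < 2 + f.totalDegree := by
  grind

lemma sum_r_mul_ne (vlt : ∀ i, v i < 2 + f.totalDegree) (wlt : ∀ i, w i < 2 + f.totalDegree)
    (ne : v ≠ w) :
    ∑ x : Fin (n + 1), (2 + f.totalDegree) ^ x.1 * v x ≠
      ∑ x : Fin (n + 1), (2 + f.totalDegree) ^ x.1 * w x := by
  intro h
  refine ne <| Finsupp.ext <| congrFun <| ofFn_inj.mp ?_
  apply ofDigits_inj_of_len_eq (Nat.lt_add_right f.totalDegree one_lt_two)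
    (by simp) (lt_up vlt) (lt_up wlt)
  simpa only [ofDigits_eq_sum_mapIdx, mapIdx_eq_ofFn, get_ofFn, length_ofFn,
    Fin.val_cast, mul_comm, sum_ofFn] using! h

lemma degreeOf_zero_t {a : k} (ha : a ≠ 0) : ((T f) (monomial v a)).degreeOf 0 =
    ∑ i : Fin (n + 1), ((2 + f.totalDegree) ^ i.1) * v i := by
  rw [← natDegree_finSuccEquiv, monomial_eq, Finsupp.prod_pow v fun a ↦ X a]
  simp only [Fin.prod_univ_succ, Fin.sum_univ_succ, map_mul, map_prod, map_pow,
    AlgEquiv.ofAlgHom_apply, MvPolynomial.aeval_C, MvPolynomial.aeval_X, if_pos, Fin.succ_ne_zero,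
    ite_false, one_smul, map_add, finSuccEquiv_X_zero, finSuccEquiv_X_succ, algebraMap_eq]
  have h (i : Fin n) :
      (Polynomial.C (X (R := k) i) + Polynomial.X ^ ((2 + f.totalDegree) ^ i.succ.1)) ^ v i.succ
        ≠ 0 :=
    pow_ne_zero (v i.succ) (leadingCoeff_ne_zero.mp <| by simp [add_comm, leadingCoeff_X_pow_add_C])
  rw [natDegree_mul (by simp [ha]) (mul_ne_zero (by simp) (Finset.prod_ne_zero_iff.mpr
    (fun i _ ↦ h i))), natDegree_mul (by simp) (Finset.prod_ne_zero_iff.mpr (fun i _ ↦ h i)),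
    natDegree_prod _ _ (fun i _ ↦ h i), natDegree_finSuccEquiv, degreeOf_C]
  simpa only [natDegree_pow, zero_add, natDegree_X, mul_one, Fin.val_zero, pow_zero, one_mul,
    add_right_inj] using Finset.sum_congr rfl (fun i _ ↦ by
    rw [add_comm (Polynomial.C _), natDegree_X_pow_add_C, mul_comm])

lemma degreeOf_t_ne_of_ne (hv : v ∈ f.support) (hw : w ∈ f.support) (ne : v ≠ w) :
    (T f <| monomial v <| coeff v f).degreeOf 0 ≠
    (T f <| monomial w <| coeff w f).degreeOf 0 := by
  rw [degreeOf_zero_t _ _ <| mem_support_iff.mp hv, degreeOf_zero_t _ _ <| mem_support_iff.mp hw]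
  refine sum_r_mul_ne f v w (fun i ↦ ?_) (fun i ↦ ?_) ne <;>
  exact lt_of_le_of_lt ((monomial_le_degreeOf i ‹_›).trans (degreeOf_le_totalDegree f i))
    (by lia)

lemma leadingCoeff_finSuccEquiv_t :
    (finSuccEquiv k n ((T f) ((monomial v) (coeff v f)))).leadingCoeff =
    algebraMap k _ (coeff v f) := by
  rw [monomial_eq, Finsupp.prod_fintype]
  · simp only [map_mul, map_prod, leadingCoeff_mul, leadingCoeff_prod]
    rw [AlgEquiv.ofAlgHom_apply, algHom_C, algebraMap_eq, finSuccEquiv_apply,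
      eval₂Hom_C, coe_comp]
    simp only [AlgEquiv.ofAlgHom_apply, Function.comp_apply, leadingCoeff_C, map_pow,
      leadingCoeff_pow, algebraMap_eq]
    have : ∀ j, ((finSuccEquiv k n) ((T1 f) 1 (X j))).leadingCoeff = 1 := fun j ↦ by
      by_cases h : j = 0
      · simp [h, finSuccEquiv_apply]
      · simp only [aeval_eq_bind₁, bind₁_X_right, if_neg h, one_smul, map_add, map_pow]
        obtain ⟨i, rfl⟩ := Fin.exists_succ_eq.mpr h
        simp [finSuccEquiv_X_succ, finSuccEquiv_X_zero, add_comm]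
    simp only [this, one_pow, Finset.prod_const_one, mul_one]
  exact fun i ↦ pow_zero _

lemma T_leadingcoeff_isUnit (fne : f ≠ 0) :
    IsUnit (finSuccEquiv k n (T f f)).leadingCoeff := by
  obtain ⟨v, vin, vs⟩ := Finset.exists_max_image f.support
    (fun v ↦ (T f ((monomial v) (coeff v f))).degreeOf 0) (support_nonempty.mpr fne)
  set h := fun w ↦ (MvPolynomial.monomial w) (coeff w f)
  simp only [← natDegree_finSuccEquiv] at vs
  replace vs : ∀ x ∈ f.support \ {v}, (finSuccEquiv k n ((T f) (h x))).degree <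
      (finSuccEquiv k n ((T f) (h v))).degree := by
    intro x hx
    obtain ⟨h1, h2⟩ := Finset.mem_sdiff.mp hx
    apply degree_lt_degree <| lt_of_le_of_ne (vs x h1) ?_
    simpa only [natDegree_finSuccEquiv]
      using degreeOf_t_ne_of_ne f _ _ h1 vin <| ne_of_not_mem_cons h2
  have coeff : (finSuccEquiv k n ((T f) (h v + ∑ x ∈ f.support \ {v}, h x))).leadingCoeff =
      (finSuccEquiv k n ((T f) (h v))).leadingCoeff := by
    simp only [map_add, map_sum]
    rw [add_comm]
    apply leadingCoeff_add_of_degree_lt <| (lt_of_le_of_lt <| degree_sum_le _ _) ?_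
    have h2 : h v ≠ 0 := by simpa [h] using mem_support_iff.mp vin
    replace h2 : (finSuccEquiv k n ((T f) (h v))) ≠ 0 := fun eq ↦ h2 <|
      by simpa only [map_eq_zero_iff _ (AlgEquiv.injective _)] using eq
    exact (Finset.sup_lt_iff <| Ne.bot_lt (fun x ↦ h2 <| degree_eq_bot.mp x)).mpr vs
  nth_rw 2 [← f.support_sum_monomial_coeff]
  rw [Finset.sum_eq_add_sum_sdiff_singleton_of_mem vin h]
  rw [leadingCoeff_finSuccEquiv_t] at coeff
  simpa only [coeff, algebraMap_eq] using (mem_support_iff.mp vin).isUnit.map MvPolynomial.C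

/-- A polynomial in `n+1` variables becomes monic in one variable under some isomorphism. -/
theorem exists_equiv_monic (fne : f ≠ 0) :
    ∃ e : MvPolynomial (Fin (n + 1)) k ≃ₐ[k] (MvPolynomial (Fin n) k)[X],
      IsUnit (e f).leadingCoeff :=
  ⟨(T f).trans (finSuccEquiv k n), T_leadingcoeff_isUnit f fne⟩

end NagataAux
namespace RegSeqAux

open Polynomial RingTheory.Sequence

/-- polynomial maps do not raise Hausdorff dimension. -/
lemma dimH_image_poly_le {a b : ℕ} (p : Fin b → MvPolynomial (Fin a) ℂ)
    (S : Set (Fin a → ℂ)) :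
    dimH ((fun x i => MvPolynomial.aeval x (p i)) '' S : Set (Fin b → ℂ)) ≤ dimH S := by
  have h : ContDiff ℝ 1 (fun (x : Fin a → ℂ) i => MvPolynomial.aeval x (p i)) := by
    rw [contDiff_pi]
    intro i
    generalize p i = q
    induction q using MvPolynomial.induction_on with
    | C c => simpa using contDiff_const
    | add f g hf hg => simpa using hf.add hg
    | mul_X f j hf => simpa using hf.mul (contDiff_apply ℝ ℂ j)
  exact h.contDiffOn.dimH_image_le convex_univ (subset_univ _)

lemma dimH_univ_Cn (m : ℕ) : dimH (univ : Set (Fin m → ℂ)) = 2 * (m : ℝ≥0∞) := by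
  rw [Real.dimH_univ_eq_finrank, Module.finrank_pi_fintype]
  simp [Complex.finrank_real_complex, mul_comm]

lemma exists_maximal_over {A R : Type*} [CommRing A] [CommRing R] (e : A ≃+* R[X])
    (I : Ideal A) (g : R[X]) (hg : g.Monic) (hgI : e.symm g ∈ I) (P : Ideal R) [P.IsMaximal]
    (hP : ∀ p : R, e.symm (Polynomial.C p) ∈ I → p ∈ P) :
    ∃ Q : Ideal A, Q.IsMaximal ∧ I ≤ Q ∧ ∀ p ∈ P, e.symm (Polynomial.C p) ∈ Q := by
  let I' : Ideal R[X] := I.comap (e.symm : R[X] →+* A)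
  have hIntegral : Algebra.IsIntegral R (R[X] ⧸ I') := ⟨hg.quotient_isIntegral (I := I') hgI⟩
  have hker : RingHom.ker (algebraMap R (R[X] ⧸ I')) ≤ P := by
    intro p hp
    apply hP
    have : Ideal.Quotient.mk I' (Polynomial.C p) = 0 := hp
    rw [Ideal.Quotient.eq_zero_iff_mem] at this
    exact this
  obtain ⟨Q, hQ, hQy⟩ := Ideal.exists_ideal_over_maximal_of_isIntegral _ hker
  have hQ1 : (Q.comap (Ideal.Quotient.mk I')).IsMaximal :=
    Ideal.comap_isMaximal_of_surjective (Ideal.Quotient.mk I') Ideal.Quotient.mk_surjective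
  refine ⟨(Q.comap (Ideal.Quotient.mk I')).comap (e : A →+* R[X]),
    Ideal.comap_isMaximal_of_surjective (e : A →+* R[X]) e.surjective, ?_, ?_⟩
  · intro p hp
    have : Ideal.Quotient.mk I' (e p) = 0 := by
      rw [Ideal.Quotient.eq_zero_iff_mem]
      simpa [I', Ideal.mem_comap] using hp
    rw [Ideal.mem_comap, Ideal.mem_comap]
    simp [this]
  · intro p hp
    rw [← hQy] at hp
    rw [Ideal.mem_comap, Ideal.mem_comap]
    have h1 : (e : A →+* R[X]) (e.symm (Polynomial.C p)) = Polynomial.C p := e.apply_symm_apply _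
    rw [h1]
    exact hp

lemma zeroLocus_comap_subset {m : ℕ} (I : Ideal (MvPolynomial (Fin (m + 1)) ℂ))
    (e : MvPolynomial (Fin (m + 1)) ℂ ≃ₐ[ℂ] (MvPolynomial (Fin m) ℂ)[X])
    (g : (MvPolynomial (Fin m) ℂ)[X]) (hg : g.Monic) (hgI : e.symm g ∈ I)
    (J : Ideal (MvPolynomial (Fin m) ℂ))
    (hJ : ∀ p, p ∈ J ↔ e.symm (Polynomial.C p) ∈ I) :
    MvPolynomial.zeroLocus ℂ J ⊆
      (fun x i => MvPolynomial.aeval x (e.symm (Polynomial.C (MvPolynomial.X i)))) ''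
        MvPolynomial.zeroLocus ℂ I := by
  intro y hy
  obtain ⟨Q, hQ, hIQ, hPQ⟩ := exists_maximal_over e.toRingEquiv I g hg hgI
    (MvPolynomial.vanishingIdeal ℂ {y}) (by
      intro p hp
      rw [MvPolynomial.mem_vanishingIdeal_singleton_iff]
      exact hy p ((hJ p).2 hp))
  obtain ⟨x, rfl⟩ := MvPolynomial.isMaximal_iff_eq_vanishingIdeal_singleton.1 hQ
  refine ⟨x, ?_, ?_⟩
  · intro p hp
    rw [← MvPolynomial.mem_vanishingIdeal_singleton_iff]
    exact hIQ hp
  · funext i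
    have h2 : e.symm (Polynomial.C (MvPolynomial.X i - MvPolynomial.C (y i))) ∈
        MvPolynomial.vanishingIdeal ℂ {x} := by
      apply hPQ
      rw [MvPolynomial.mem_vanishingIdeal_singleton_iff]; simp
    rw [MvPolynomial.mem_vanishingIdeal_singleton_iff, Polynomial.C_sub, map_sub, map_sub,
      sub_eq_zero] at h2
    simp only
    rw [h2]
    have h3 : (Polynomial.C (MvPolynomial.C (y i)) : (MvPolynomial (Fin m) ℂ)[X])
      = algebraMap ℂ _ (y i) := rfl
    rw [h3, AlgEquiv.commutes]
    simp

/-- Regular sequences lift along `R → R[X]/(g)`, `g` monic. -/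
lemma weaklyRegular_cons {R : Type*} [CommRing R] (g : R[X]) (hg : g.Monic)
    (rs : List R) (h : IsWeaklyRegular R rs) :
    IsWeaklyRegular R[X] (g :: rs.map Polynomial.C) := by
  have := hg.free_quotient
  have h1 : IsWeaklyRegular (R[X] ⧸ Ideal.span {g}) (rs.map (algebraMap R (R[X] ⧸ Ideal.span {g}))) :=
    h.of_flat
  rw [isWeaklyRegular_cons_iff]
  constructor
  · intro a b hab
    have : g * (a - b) = 0 := by
      rw [mul_sub, sub_eq_zero]; exact hab
    exact sub_eq_zero.1 ((hg.mul_right_eq_zero_iff).1 this)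
  · rw [isWeaklyRegular_map_algebraMap_iff] at h1
    have h2 : IsWeaklyRegular (R[X] ⧸ Ideal.span {g}) (rs.map (algebraMap R R[X])) := by
      rw [isWeaklyRegular_map_algebraMap_iff]; exact h1
    have e : QuotSMulTop g R[X] ≃ₗ[R[X]] (R[X] ⧸ Ideal.span {g}) := by
      refine Submodule.quotEquivOfEq _ _ ?_
      rw [← Submodule.ideal_span_singleton_smul]
      simp
    exact (e.isWeaklyRegular_congr _).2 h2

/-- An ideal of polynomials whose zero set has (Hausdorff) codimension at least `k` contains
a weakly regular sequence of length `k`. -/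
theorem exists_regular (k : ℕ) : ∀ (m : ℕ) (I : Ideal (MvPolynomial (Fin m) ℂ)),
    dimH (MvPolynomial.zeroLocus ℂ I) + 2 * (k : ℝ≥0∞) ≤ 2 * (m : ℝ≥0∞) →
    ∃ rs : List (MvPolynomial (Fin m) ℂ), rs.length = k ∧ (∀ r ∈ rs, r ∈ I) ∧
      IsWeaklyRegular (MvPolynomial (Fin m) ℂ) rs := by
  induction k with
  | zero => intro m I _; exact ⟨[], by simp, by simp, by simp⟩
  | succ k ih =>
    intro m I h
    have hm : (2 : ℝ≥0∞) * ((k + 1 : ℕ) : ℝ≥0∞) ≤ 2 * (m : ℝ≥0∞) := le_trans le_add_self h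
    have hm' : k + 1 ≤ m := by
      have : ((2 * (k + 1) : ℕ) : ℝ≥0∞) ≤ ((2 * m : ℕ) : ℝ≥0∞) := by push_cast; exact_mod_cast hm
      have := Nat.cast_le.1 this
      omega
    obtain ⟨m, rfl⟩ : ∃ m', m = m' + 1 := ⟨m - 1, by omega⟩
    have hI : I ≠ ⊥ := by
      rintro rfl
      rw [MvPolynomial.zeroLocus_bot, Set.top_eq_univ, dimH_univ_Cn] at h
      have h' : ((2 * (m + 1) + 2 * (k + 1) : ℕ) : ℝ≥0∞) ≤ ((2 * (m + 1) : ℕ) : ℝ≥0∞) := by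
        push_cast; exact_mod_cast h
      have := Nat.cast_le.1 h'
      omega
    obtain ⟨f, hfI, hf0⟩ := Submodule.exists_mem_ne_zero_of_ne_bot hI
    obtain ⟨e, he⟩ := NagataAux.exists_equiv_monic f hf0
    obtain ⟨u, hu⟩ := he
    set g : (MvPolynomial (Fin m) ℂ)[X] := Polynomial.C (↑u⁻¹ : MvPolynomial (Fin m) ℂ) * e f
      with hgdef
    have hg : g.Monic := by
      have := Polynomial.monic_of_isUnit_leadingCoeff_inv_smul (p := e f) ⟨u, hu⟩
      have h2 : (IsUnit.unit (⟨u, hu⟩ : IsUnit (e f).leadingCoeff)) = u := by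
        exact Units.ext hu.symm
      rw [h2, Units.smul_def, Polynomial.smul_eq_C_mul] at this
      exact this
    have hgI : e.symm g ∈ I := by
      rw [hgdef, map_mul, AlgEquiv.symm_apply_apply]
      exact I.mul_mem_left _ hfI
    obtain ⟨J, hJ⟩ : ∃ J : Ideal (MvPolynomial (Fin m) ℂ),
        ∀ p, p ∈ J ↔ e.symm (Polynomial.C p) ∈ I :=
      ⟨(I.comap (e.symm : (MvPolynomial (Fin m) ℂ)[X] →+* _)).comap Polynomial.C,
        fun p => Iff.rfl⟩
    obtain ⟨rs, hlen, hmem, hreg⟩ := ih m J (by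
        have h1 := (dimH_mono (zeroLocus_comap_subset I e g hg hgI J hJ)).trans
          (dimH_image_poly_le _ _)
        have h2 := (add_le_add_left h1 (2 * ((k + 1 : ℕ) : ℝ≥0∞))).trans h
        push_cast at h2
        rw [mul_add, mul_add, ← add_assoc] at h2
        exact (ENNReal.add_le_add_iff_right (by simp)).1 h2)
    refine ⟨(g :: rs.map Polynomial.C).map e.symm, by simp [hlen], ?_, ?_⟩
    · intro r hr
      rw [List.map_cons, List.mem_cons] at hr
      rcases hr with rfl | hr
      · exact hgI
      · rw [List.map_map, List.mem_map] at hr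
        obtain ⟨s, hs, rfl⟩ := hr
        exact (hJ s).1 (hmem s hs)
    · have h3 := weaklyRegular_cons g hg rs hreg
      refine (AddEquiv.isWeaklyRegular_congr (e := e.symm.toRingEquiv.toAddEquiv) ?_).1 h3
      refine List.forall₂_map_right_iff.mpr (List.forall₂_same.mpr fun r _ x => ?_)
      exact map_mul e.symm r x

/-- Explicit form for length `3`. -/
theorem exists_regular_three (m : ℕ) (I : Ideal (MvPolynomial (Fin m) ℂ))
    (h : dimH (MvPolynomial.zeroLocus ℂ I) + 6 ≤ 2 * (m : ℝ≥0∞)) :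
    ∃ f ∈ I, ∃ g ∈ I, ∃ r ∈ I, f ≠ 0 ∧ (∀ a, f ∣ g * a → f ∣ a) ∧
      ∀ a, (∃ b c, r * a = f * b + g * c) → ∃ b c, a = f * b + g * c := by
  obtain ⟨rs, hlen, hmem, hreg⟩ := exists_regular 3 m I (by convert h using 2; norm_num)
  match rs, hlen with
  | [f, g, r], _ =>
    have key : ∀ (rs : List (MvPolynomial (Fin m) ℂ)) (s a : MvPolynomial (Fin m) ℂ),
        IsSMulRegular (MvPolynomial (Fin m) ℂ ⧸
          (Ideal.ofList rs • ⊤ : Submodule (MvPolynomial (Fin m) ℂ) (MvPolynomial (Fin m) ℂ))) s →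
        s * a ∈ Ideal.ofList rs → a ∈ Ideal.ofList rs := by
      intro rs s a hs hsa
      have h1 : (Ideal.ofList rs • ⊤ : Submodule (MvPolynomial (Fin m) ℂ) (MvPolynomial (Fin m) ℂ)) = Ideal.ofList rs := by
        simp
      rw [h1] at hs
      have h2 := @hs (Submodule.Quotient.mk a) 0 (by
        simp only [smul_zero]
        rw [← Submodule.Quotient.mk_smul, Submodule.Quotient.mk_eq_zero]
        exact hsa)
      rwa [Submodule.Quotient.mk_eq_zero] at h2
    have k0 := fun a => key _ _ a (hreg.regular_mod_prev 0 (by simp))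
    have k1 := fun a => key _ _ a (hreg.regular_mod_prev 1 (by simp))
    have k2 := fun a => key _ _ a (hreg.regular_mod_prev 2 (by simp))
    simp only [List.take, List.getElem_cons_zero, List.getElem_cons_succ, Ideal.ofList_nil,
      Ideal.ofList_cons, Ideal.mem_bot, sup_bot_eq, Ideal.mem_span_singleton] at k0 k1 k2
    refine ⟨f, hmem f (by simp), g, hmem g (by simp), r, hmem r (by simp), ?_, k1, ?_⟩
    · intro hf
      have := k0 1 (by simp [hf])
      exact one_ne_zero this
    · have hsup : ∀ a, a ∈ Ideal.span {f} ⊔ Ideal.span {g} ↔ ∃ b c, a = f * b + g * c := by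
        intro a
        rw [← Ideal.span_insert, Ideal.mem_span_pair]
        constructor
        · rintro ⟨b, c, rfl⟩; exact ⟨b, c, by ring⟩
        · rintro ⟨b, c, rfl⟩; exact ⟨b, c, by ring⟩
      intro a ha
      rw [← hsup] at ha ⊢
      exact k2 a ha

end RegSeqAux

namespace LinAux

open Matrix

variable {E : Type*} [AddCommGroup E] [Module ℂ E] {m : ℕ}

/-- the form `Φ(V, R, x, v)` -/
def ctr (Φ : E [⋀^Fin (m + 3)]→ₗ[ℂ] ℂ) (V R : E) : E [⋀^Fin (m + 1)]→ₗ[ℂ] ℂ :=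
  (Φ.curryLeft V).curryLeft R

theorem ctr_apply (Φ : E [⋀^Fin (m + 3)]→ₗ[ℂ] ℂ) (V R : E) (u : Fin (m + 1) → E) :
    ctr Φ V R u = Φ (vecCons V (vecCons R u)) := rfl

theorem alt_sum_apply {k : ℕ} {ι : Type*} (s : Finset ι) (f : ι → E [⋀^Fin k]→ₗ[ℂ] ℂ)
    (v : Fin k → E) : (∑ i ∈ s, f i) v = ∑ i ∈ s, f i v := by
  classical
  induction s using Finset.induction_on with
  | empty => simp
  | insert a s ha ih => rw [Finset.sum_insert ha, Finset.sum_insert ha,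
      AlternatingMap.add_apply, ih]

theorem linInd_of_ne (Φ : E [⋀^Fin (m + 3)]→ₗ[ℂ] ℂ) (u : Fin (m + 3) → E) (h : Φ u ≠ 0) :
    LinearIndependent ℂ u := by
  by_contra hc
  exact h (Φ.map_linearDependent u hc)

theorem ctr_zero_left (Φ : E [⋀^Fin (m + 3)]→ₗ[ℂ] ℂ) (V R : E) (u : Fin (m + 1) → E)
    (i : Fin (m + 1)) (h : u i = V) : ctr Φ V R u = 0 := by
  rw [ctr_apply]
  refine Φ.map_eq_zero_of_eq _ (i := 0) (j := i.succ.succ) ?_ (Fin.succ_ne_zero _).symm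
  simp [h]

theorem ctr_zero_right (Φ : E [⋀^Fin (m + 3)]→ₗ[ℂ] ℂ) (V R : E) (u : Fin (m + 1) → E)
    (i : Fin (m + 1)) (h : u i = R) : ctr Φ V R u = 0 := by
  rw [ctr_apply]
  refine Φ.map_eq_zero_of_eq _ (i := (0 : Fin _).succ) (j := i.succ.succ) ?_ ?_
  · simp [h]
  · intro hh
    exact (Fin.succ_ne_zero i).symm (Fin.succ_injective _ hh)

/-- the dual vector -/
def dualVec (ω : E [⋀^Fin m]→ₗ[ℂ] ℂ) (w : Fin (m + 1) → E) : E :=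
  ∑ k : Fin (m + 1), ((-1 : ℂ) ^ (k : ℕ) * ω (fun j => w (k.succAbove j))) • w k

theorem ctr_dualVec (Φ : E [⋀^Fin (m + 3)]→ₗ[ℂ] ℂ) (V R : E) (w : Fin (m + 1) → E)
    (ω : E [⋀^Fin m]→ₗ[ℂ] ℂ) (k : Fin (m + 1)) :
    ctr Φ V R (vecCons (dualVec ω w) (fun j => w (k.succAbove j))) =
      ctr Φ V R w * ω (fun j => w (k.succAbove j)) := by
  have h1 : ctr Φ V R (vecCons (dualVec ω w) (fun j => w (k.succAbove j))) =
      ∑ l : Fin (m + 1), ((-1 : ℂ) ^ (l : ℕ) * ω (fun j => w (l.succAbove j))) *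
        ctr Φ V R (vecCons (w l) (fun j => w (k.succAbove j))) := by
    rw [← AlternatingMap.curryLeft_apply_apply, dualVec, map_sum, alt_sum_apply]
    refine Finset.sum_congr rfl fun l _ => ?_
    rw [map_smul]; rfl
  rw [h1, Finset.sum_eq_single k]
  · have h2 := AlternatingMap.neg_one_pow_smul_map_insertNth (ctr Φ V R) k (w k)
      (fun j => w (k.succAbove j))
    have h3 : k.insertNth (w k) (fun j => w (k.succAbove j)) = w := by
      have := Fin.insertNth_self_removeNth k w
      exact this
    have h4 : ((-1 : ℂ) ^ (k : ℕ)) * (-1) ^ (k : ℕ) = 1 := by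
      rw [← mul_pow]; simp
    rw [← h2, h3, zsmul_eq_mul]
    push_cast
    linear_combination (ω (fun j => w (k.succAbove j)) * (ctr Φ V R) w) * h4
  · intro l _ hl
    obtain ⟨j, hj⟩ := Fin.exists_succAbove_eq hl
    rw [(ctr Φ V R).map_eq_zero_of_eq _ (i := 0) (j := j.succ) (by simp [hj])
      (Fin.succ_ne_zero _).symm, mul_zero]
  · simp

theorem form_eq [FiniteDimensional ℂ E] (hE : Module.finrank ℂ E = m + 3)
    (Φ : E [⋀^Fin (m + 3)]→ₗ[ℂ] ℂ) (V R : E) (w : Fin (m + 1) → E)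
    (ω : E [⋀^Fin m]→ₗ[ℂ] ℂ) (hΔ : ctr Φ V R w ≠ 0)
    (hV : ∀ v i, v i = V → ω v = 0) (hR : ∀ v i, v i = R → ω v = 0) (v : Fin m → E) :
    ctr Φ V R w * ω v = ctr Φ V R (vecCons (dualVec ω w) v) := by
  have hli := linInd_of_ne Φ _ hΔ
  let b := basisOfLinearIndependentOfCardEqFinrank hli (by simp [hE])
  have hb : ∀ i, b i = vecCons V (vecCons R w) i := fun i => by
    simp only [b, coe_basisOfLinearIndependentOfCardEqFinrank]; rfl
  have key : ctr Φ V R w • ω = (ctr Φ V R).curryLeft (dualVec ω w) := by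
    refine b.ext_alternating fun τ hτ => ?_
    by_cases h0 : ∃ j, τ j = 0
    · obtain ⟨j, hj⟩ := h0
      have e : b (τ j) = V := by rw [hb, hj]; rfl
      rw [AlternatingMap.smul_apply, hV _ j e, AlternatingMap.curryLeft_apply_apply,
        smul_zero]
      exact (ctr_zero_left Φ V R _ j.succ e).symm
    by_cases h1 : ∃ j, τ j = (0 : Fin (m + 2)).succ
    · obtain ⟨j, hj⟩ := h1
      have e : b (τ j) = R := by rw [hb, hj]; rfl
      rw [AlternatingMap.smul_apply, hR _ j e, AlternatingMap.curryLeft_apply_apply,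
        smul_zero]
      exact (ctr_zero_right Φ V R _ j.succ e).symm
    push Not at h0 h1
    have hs : ∀ j, ∃ s : Fin (m + 1), s.succ.succ = τ j := by
      intro j
      obtain ⟨t, ht⟩ := Fin.exists_succ_eq.2 (h0 j)
      have : t ≠ 0 := by rintro rfl; exact h1 j ht.symm
      obtain ⟨s, hs⟩ := Fin.exists_succ_eq.2 this
      exact ⟨s, by rw [hs, ht]⟩
    choose s hs using hs
    have hsi : Function.Injective s := fun a c hac => hτ (by rw [← hs, ← hs, hac])
    obtain ⟨k, hk⟩ : ∃ k, ∀ j, s j ≠ k := by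
      by_contra hc
      push Not at hc
      have := Fintype.card_le_of_surjective s hc
      simp at this
    choose p hp using fun j => Fin.exists_succAbove_eq (hk j)
    have hpi : Function.Injective p := fun a c hac => hsi (by rw [← hp, ← hp, hac])
    let σ : Equiv.Perm (Fin m) := Equiv.ofBijective p (Finite.injective_iff_bijective.1 hpi)
    have hbt : (fun i => b (τ i)) = (fun j => w (k.succAbove j)) ∘ σ := by
      funext i
      rw [hb, ← hs]
      change w (s i) = w (k.succAbove (p i))
      rw [hp]
    rw [AlternatingMap.smul_apply, hbt, AlternatingMap.map_perm, AlternatingMap.map_perm,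
      AlternatingMap.curryLeft_apply_apply, ctr_dualVec, smul_comm, smul_eq_mul]
  have := congrArg (fun f => f v) key
  simpa using this

theorem vec_eq [FiniteDimensional ℂ E] (hE : Module.finrank ℂ E = m + 3)
    (Φ : E [⋀^Fin (m + 3)]→ₗ[ℂ] ℂ) (V R : E) (w : Fin (m + 1) → E)
    (hΔ : ctr Φ V R w ≠ 0) (Z : E) (hZ : ∀ v, ctr Φ V R (vecCons Z v) = 0) :
    ctr Φ V R w • Z = ctr Φ Z R w • V + ctr Φ V Z w • R := by
  have hli := linInd_of_ne Φ _ hΔ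
  let b := basisOfLinearIndependentOfCardEqFinrank hli (by simp [hE])
  have hb : ∀ i, b i = vecCons V (vecCons R w) i := fun i => by
    simp only [b, coe_basisOfLinearIndependentOfCardEqFinrank]; rfl
  have hz : Z = b.repr Z 0 • V + (b.repr Z (0 : Fin (m+2)).succ • R +
      ∑ k : Fin (m + 1), b.repr Z k.succ.succ • w k) := by
    conv_lhs => rw [← b.sum_repr Z]
    rw [Fin.sum_univ_succ, Fin.sum_univ_succ]
    simp only [hb]; rfl
  set a := b.repr Z 0
  set c := b.repr Z (0 : Fin (m+2)).succ
  have hk : ∀ k : Fin (m + 1), b.repr Z k.succ.succ = 0 := by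
    intro k
    have h1 := hZ (fun j => w (k.succAbove j))
    rw [← AlternatingMap.curryLeft_apply_apply, hz, map_add, map_add, map_smul, map_smul, map_sum,
      AlternatingMap.add_apply, AlternatingMap.add_apply, alt_sum_apply,
      Finset.sum_eq_single k] at h1
    · simp only [map_smul, AlternatingMap.smul_apply, AlternatingMap.curryLeft_apply_apply] at h1
      rw [ctr_zero_left Φ V R _ 0 (by simp), ctr_zero_right Φ V R _ 0 (by simp)] at h1
      have h2 := AlternatingMap.neg_one_pow_smul_map_insertNth (ctr Φ V R) k (w k)
        (fun j => w (k.succAbove j))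
      have h3 : k.insertNth (w k) (fun j => w (k.succAbove j)) = w := by
        have := Fin.insertNth_self_removeNth k w
        exact this
      rw [← h2, h3] at h1
      simpa [hΔ] using h1
    · intro l _ hl
      obtain ⟨j, hj⟩ := Fin.exists_succAbove_eq hl
      rw [map_smul, AlternatingMap.smul_apply, AlternatingMap.curryLeft_apply_apply,
        (ctr Φ V R).map_eq_zero_of_eq _ (i := 0) (j := j.succ) (by simp [hj])
        (Fin.succ_ne_zero _).symm, smul_zero]
    · simp
  have hz' : Z = a • V + c • R := by
    rw [hz]; simp [hk]
  have e1 : ctr Φ Z R w = a * ctr Φ V R w := by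
    have h0 : ctr Φ R R w = 0 := by
      rw [ctr_apply]
      exact Φ.map_eq_zero_of_eq _ (i := 0) (j := (0 : Fin (m+2)).succ) (by simp)
        (Fin.succ_ne_zero _).symm
    have : ∀ X, ctr Φ X R w = Φ.curryLeft X (vecCons R w) := fun _ => rfl
    rw [this, hz', map_add, map_smul, map_smul, AlternatingMap.add_apply,
      AlternatingMap.smul_apply, AlternatingMap.smul_apply, ← this, ← this, h0]
    simp
  have e2 : ctr Φ V Z w = c * ctr Φ V R w := by
    have h0 : ctr Φ V V w = 0 := by
      rw [ctr_apply]
      exact Φ.map_eq_zero_of_eq _ (i := 0) (j := (0 : Fin (m+2)).succ) (by simp)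
        (Fin.succ_ne_zero _).symm
    have : ∀ X, ctr Φ V X w = (Φ.curryLeft V).curryLeft X w := fun _ => rfl
    rw [this, hz', map_add, map_smul, map_smul, AlternatingMap.add_apply,
      AlternatingMap.smul_apply, AlternatingMap.smul_apply, ← this, ← this, h0]
    simp
  rw [e1, e2]
  conv_lhs => rw [hz']
  module

end LinAux

namespace PolyAux

open Matrix LinAux

variable {N m : ℕ}

abbrev PA (N : ℕ) : Type := MvPolynomial (Fin N) ℂ

/-- evaluation of a polynomial vector field -/
noncomputable def ev (Y : Fin N → PA N) (z : Fin N → ℂ) : Fin N → ℂ := fun i => MvPolynomial.eval z (Y i)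

@[simp] theorem ev_add (Y Z : Fin N → PA N) (z : Fin N → ℂ) : ev (Y + Z) z = ev Y z + ev Z z := by
  funext i; simp [ev]

@[simp] theorem ev_sub (Y Z : Fin N → PA N) (z : Fin N → ℂ) : ev (Y - Z) z = ev Y z - ev Z z := by
  funext i; simp [ev]

@[simp] theorem ev_smul (f : PA N) (Y : Fin N → PA N) (z : Fin N → ℂ) :
    ev (f • Y) z = MvPolynomial.eval z f • ev Y z := by
  funext i; simp [ev]

@[simp] theorem ev_X (z : Fin N → ℂ) : ev (fun i => MvPolynomial.X i : Fin N → PA N) z = z := by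
  funext i; simp [ev]

@[simp] theorem ev_zero (z : Fin N → ℂ) : ev (0 : Fin N → PA N) z = 0 := by
  funext i; simp [ev]

theorem ev_inj {Y Z : Fin N → PA N} (h : ∀ z, ev Y z = ev Z z) : Y = Z := by
  funext i
  exact MvPolynomial.funext fun z => congrFun (h z) i

/-- extension to a frame -/
theorem exists_frame (hN : N = m + 3) (Φ : (Fin N → ℂ) [⋀^Fin (m + 3)]→ₗ[ℂ] ℂ) (hΦ : Φ ≠ 0)
    (V R : Fin N → ℂ) (h : LinearIndependent ℂ ![V, R]) :
    ∃ w : Fin (m + 1) → (Fin N → ℂ), ctr Φ V R w ≠ 0 := by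
  have key : ∀ j, j ≤ m + 1 → ∃ w : Fin j → (Fin N → ℂ),
      LinearIndependent ℂ (vecCons V (vecCons R w)) := by
    intro j
    induction j with
    | zero =>
      intro _
      refine ⟨![], h⟩
    | succ j ih =>
      intro hj
      obtain ⟨w, hw⟩ := ih (by omega)
      obtain ⟨x, hx⟩ := exists_linearIndependent_snoc_of_lt_finrank hw (by simp; omega)
      refine ⟨Fin.snoc w x, ?_⟩
      have : (vecCons V (vecCons R (Fin.snoc w x : Fin (j+1) → (Fin N → ℂ)))) =
          Fin.snoc (vecCons V (vecCons R w)) x := by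
        simp only [vecCons, Fin.cons_snoc_eq_snoc_cons]
      rw [this]; exact hx
  obtain ⟨w, hw⟩ := key (m + 1) le_rfl
  refine ⟨w, ?_⟩
  let b := basisOfLinearIndependentOfCardEqFinrank hw (by simp [hN])
  have := (AlternatingMap.map_basis_ne_zero_iff b Φ).2 hΦ
  rw [coe_basisOfLinearIndependentOfCardEqFinrank] at this
  exact this

theorem linind_pair (Φ : (Fin N → ℂ) [⋀^Fin (m + 3)]→ₗ[ℂ] ℂ)
    (V R : Fin N → ℂ) (w : Fin (m + 1) → (Fin N → ℂ)) (h : ctr Φ V R w ≠ 0) (a b : ℂ)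
    (hab : a • V + b • R = 0) : a = 0 ∧ b = 0 := by
  have hli := linInd_of_ne Φ _ h
  have h2 := hli.comp ![0, (0 : Fin (m+2)).succ] (by
    intro i j hij
    fin_cases i <;> fin_cases j <;> simp at hij ⊢)
  have h3 : (vecCons V (vecCons R w)) ∘ ![0, (0 : Fin (m+2)).succ] = ![V, R] := by
    funext i; fin_cases i <;> rfl
  have h4 : LinearIndependent ℂ ![V, R] := by rw [← h3]; exact h2
  exact LinearIndependent.pair_iff.1 h4 a b hab

theorem ctr_poly (Φ : (Fin N → ℂ) [⋀^Fin (m + 3)]→ₗ[ℂ] ℂ) (P Q : Fin N → PA N)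
    (w : Fin (m + 1) → (Fin N → ℂ)) :
    ∃ p : PA N, ∀ z, MvPolynomial.eval z p = ctr Φ (ev P z) (ev Q z) w := by
  refine ⟨∑ i, ∑ j, P i * (Q j * MvPolynomial.C (ctr Φ (Pi.single i 1) (Pi.single j 1) w)),
    fun z => ?_⟩
  have hs : ∀ P : Fin N → PA N, ev P z = ∑ i, MvPolynomial.eval z (P i) • Pi.single i (1 : ℂ) := by
    intro P
    exact pi_eq_sum_univ' _ |>.trans (by
      refine Finset.sum_congr rfl fun i _ => ?_
      congr 1)
  have e1 : ∀ X Y, ctr Φ X Y w = (Φ.curryLeft X).curryLeft Y w := fun _ _ => rfl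
  rw [e1, hs P, hs Q, map_sum, map_sum Φ.curryLeft]
  have e2 : ∀ Y, (∑ x, Φ.curryLeft (MvPolynomial.eval z (P x) • Pi.single x 1)).curryLeft Y w =
      ∑ x, MvPolynomial.eval z (P x) * (Φ.curryLeft (Pi.single x 1)).curryLeft Y w := by
    intro Y
    rw [AlternatingMap.curryLeft_apply_apply, alt_sum_apply]
    refine Finset.sum_congr rfl fun x _ => ?_
    rw [map_smul]; rfl
  rw [e2]
  refine Finset.sum_congr rfl fun i _ => ?_
  rw [map_sum, map_sum, alt_sum_apply, Finset.mul_sum]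
  refine Finset.sum_congr rfl fun j _ => ?_
  rw [map_smul, AlternatingMap.smul_apply, smul_eq_mul]
  simp [e1]

theorem ctr_cons_poly (Φ : (Fin N → ℂ) [⋀^Fin (m + 3)]→ₗ[ℂ] ℂ) (P Q Y : Fin N → PA N)
    (v : Fin m → (Fin N → ℂ)) :
    ∃ p : PA N, ∀ z, MvPolynomial.eval z p = ctr Φ (ev P z) (ev Q z) (vecCons (ev Y z) v) := by
  choose q hq using fun k : Fin N => ctr_poly Φ P Q (vecCons (Pi.single k (1 : ℂ)) v)
  refine ⟨∑ k, Y k * q k, fun z => ?_⟩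
  have hs : ev Y z = ∑ i, MvPolynomial.eval z (Y i) • Pi.single i (1 : ℂ) := by
    exact pi_eq_sum_univ' _ |>.trans (by
      refine Finset.sum_congr rfl fun i _ => ?_
      congr 1)
  rw [hs, ← AlternatingMap.curryLeft_apply_apply, map_sum, map_sum, alt_sum_apply]
  refine Finset.sum_congr rfl fun i _ => ?_
  rw [map_mul, hq, map_smul]
  rfl

theorem dual_poly (ω : (Fin N → ℂ) → (Fin N → ℂ) [⋀^Fin m]→ₗ[ℂ] ℂ)
    (hω : ∀ v, ∃ p : PA N, ∀ z, ω z v = MvPolynomial.eval z p) (w : Fin (m + 1) → (Fin N → ℂ)) :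
    ∃ Y : Fin N → PA N, ∀ z, ev Y z = dualVec (ω z) w := by
  choose p hp using hω
  refine ⟨fun i => ∑ k : Fin (m + 1), (MvPolynomial.C ((-1 : ℂ) ^ (k : ℕ)) *
    p (fun j => w (k.succAbove j))) * MvPolynomial.C (w k i), fun z => ?_⟩
  funext i
  simp [ev, dualVec, hp]

theorem ctr_cons_add (Ψ : (Fin N → ℂ) [⋀^Fin (m + 1)]→ₗ[ℂ] ℂ) (x y : Fin N → ℂ)
    (v : Fin m → (Fin N → ℂ)) : Ψ (vecCons (x + y) v) = Ψ (vecCons x v) + Ψ (vecCons y v) := by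
  simp only [← AlternatingMap.curryLeft_apply_apply, map_add, AlternatingMap.add_apply]

theorem ctr_cons_sub (Ψ : (Fin N → ℂ) [⋀^Fin (m + 1)]→ₗ[ℂ] ℂ) (x y : Fin N → ℂ)
    (v : Fin m → (Fin N → ℂ)) : Ψ (vecCons (x - y) v) = Ψ (vecCons x v) - Ψ (vecCons y v) := by
  simp only [← AlternatingMap.curryLeft_apply_apply, map_sub, AlternatingMap.sub_apply]

theorem ctr_cons_smul (Ψ : (Fin N → ℂ) [⋀^Fin (m + 1)]→ₗ[ℂ] ℂ) (c : ℂ) (x : Fin N → ℂ)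
    (v : Fin m → (Fin N → ℂ)) : Ψ (vecCons (c • x) v) = c * Ψ (vecCons x v) := by
  simp only [← AlternatingMap.curryLeft_apply_apply, map_smul, AlternatingMap.smul_apply,
    smul_eq_mul]

/-- the Euler field -/
noncomputable def RX (N : ℕ) : Fin N → PA N := fun i => MvPolynomial.X i

/-- the ideal of good multipliers -/
def goodIdeal (Φ : (Fin N → ℂ) [⋀^Fin (m + 3)]→ₗ[ℂ] ℂ) (V : Fin N → PA N)
    (ω : (Fin N → ℂ) → (Fin N → ℂ) [⋀^Fin m]→ₗ[ℂ] ℂ) : Ideal (PA N) where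
  carrier := {f | (∃ Y : Fin N → PA N, ∀ z v, MvPolynomial.eval z f * ω z v =
      ctr Φ (ev V z) z (vecCons (ev Y z) v)) ∧
    ∀ Z : Fin N → PA N, (∀ z v, ctr Φ (ev V z) z (vecCons (ev Z z) v) = 0) →
      ∃ a b : PA N, f • Z = a • V + b • RX N}
  zero_mem' := by
    refine ⟨⟨0, fun z v => ?_⟩, fun Z _ => ⟨0, 0, by simp⟩⟩
    rw [map_zero, zero_mul, ev_zero, (ctr Φ (ev V z) z).map_coord_zero 0 (by simp)]
  add_mem' := by
    rintro f g ⟨⟨Y, hY⟩, hf⟩ ⟨⟨Y', hY'⟩, hg⟩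
    refine ⟨⟨Y + Y', fun z v => ?_⟩, fun Z hZ => ?_⟩
    · rw [map_add, add_mul, hY, hY', ev_add, ctr_cons_add]
    · obtain ⟨a, b, h⟩ := hf Z hZ
      obtain ⟨a', b', h'⟩ := hg Z hZ
      refine ⟨a + a', b + b', ?_⟩
      rw [add_smul, h, h']; module
  smul_mem' := by
    rintro c f ⟨⟨Y, hY⟩, hf⟩
    refine ⟨⟨c • Y, fun z v => ?_⟩, fun Z hZ => ?_⟩
    · rw [smul_eq_mul, map_mul, mul_assoc, hY, ev_smul, ctr_cons_smul]
    · obtain ⟨a, b, h⟩ := hf Z hZ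
      refine ⟨c * a, c * b, ?_⟩
      rw [smul_eq_mul, mul_smul, h]; module

theorem sq_mem (hN : N = m + 3) (Φ : (Fin N → ℂ) [⋀^Fin (m + 3)]→ₗ[ℂ] ℂ) (V : Fin N → PA N)
    (ω : (Fin N → ℂ) → (Fin N → ℂ) [⋀^Fin m]→ₗ[ℂ] ℂ)
    (hω : ∀ v, ∃ p : PA N, ∀ z, ω z v = MvPolynomial.eval z p)
    (hV : ∀ z v i, v i = ev V z → ω z v = 0) (hR : ∀ z v i, v i = z → ω z v = 0)
    (w : Fin (m + 1) → (Fin N → ℂ)) (Δ : PA N)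
    (hΔ : ∀ z, MvPolynomial.eval z Δ = ctr Φ (ev V z) z w) :
    Δ * Δ ∈ goodIdeal Φ V ω := by
  have hE : Module.finrank ℂ (Fin N → ℂ) = m + 3 := by simp [hN]
  constructor
  · obtain ⟨Y, hY⟩ := dual_poly ω hω w
    refine ⟨Δ • Y, fun z v => ?_⟩
    rw [map_mul, ev_smul, ctr_cons_smul, hY, mul_assoc]
    by_cases h0 : MvPolynomial.eval z Δ = 0
    · rw [h0]; simp
    · congr 1
      rw [hΔ] at h0 ⊢
      exact form_eq hE Φ _ _ w (ω z) h0 (hV z) (hR z) v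
  · intro Z hZ
    obtain ⟨a, ha⟩ := ctr_poly Φ Z (RX N) w
    obtain ⟨b, hb⟩ := ctr_poly Φ V Z w
    refine ⟨Δ * a, Δ * b, ev_inj fun z => ?_⟩
    have hX : ev (RX N) z = z := ev_X z
    rw [ev_add, ev_smul, ev_smul, ev_smul, map_mul, map_mul, map_mul, hX]
    by_cases h0 : MvPolynomial.eval z Δ = 0
    · rw [h0]; simp
    · rw [ha, hb, mul_smul, mul_smul, mul_smul, ← smul_add]
      congr 1
      rw [hΔ] at h0 ⊢
      rw [hX]
      exact vec_eq hE Φ _ _ w h0 _ (hZ z)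

theorem main_poly (hN : N = m + 3) (Φ : (Fin N → ℂ) [⋀^Fin (m + 3)]→ₗ[ℂ] ℂ) (hΦ : Φ ≠ 0)
    (V : Fin N → PA N)
    (ω : (Fin N → ℂ) → (Fin N → ℂ) [⋀^Fin m]→ₗ[ℂ] ℂ)
    (hω : ∀ v, ∃ p : PA N, ∀ z, ω z v = MvPolynomial.eval z p)
    (hV : ∀ z v i, v i = ev V z → ω z v = 0) (hR : ∀ z v i, v i = z → ω z v = 0)
    (S : Set (Fin N → ℂ)) (hS : ∀ z, z ∉ S → LinearIndependent ℂ ![ev V z, z])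
    (hdim : dimH S + 6 ≤ 2 * (N : ℝ≥0∞)) :
    ∃ Y : Fin N → PA N, ∀ z v, ω z v = ctr Φ (ev V z) z (vecCons (ev Y z) v) := by
  have hgood : ∀ z ∉ S, ∃ (w : Fin (m + 1) → (Fin N → ℂ)) (Δ : PA N),
      (∀ z, MvPolynomial.eval z Δ = ctr Φ (ev V z) z w) ∧ MvPolynomial.eval z Δ ≠ 0 := by
    intro z hz
    obtain ⟨w, hw⟩ := exists_frame hN Φ hΦ _ _ (hS z hz)
    obtain ⟨Δ, hΔ⟩ := ctr_poly Φ V (RX N) w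
    have hX : ∀ z, ev (RX N) z = z := fun z => ev_X z
    simp only [hX] at hΔ
    exact ⟨w, Δ, hΔ, by rw [hΔ]; exact hw⟩
  have hsub : MvPolynomial.zeroLocus ℂ (goodIdeal Φ V ω) ⊆ S := by
    intro z hz
    by_contra hzS
    obtain ⟨w, Δ, hΔ, h0⟩ := hgood z hzS
    have := hz _ (sq_mem hN Φ V ω hω hV hR w Δ hΔ)
    rw [MvPolynomial.aeval_eq_eval, map_mul] at this
    exact h0 (mul_self_eq_zero.1 this)
  obtain ⟨f, hf, g, hg, r, hr, hf0, hreg2, hreg3⟩ := RegSeqAux.exists_regular_three N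
    (goodIdeal Φ V ω) (le_trans (by gcongr) hdim)
  have hne : ∃ z, z ∉ S := by
    by_contra hc
    push Not at hc
    have hS' : S = Set.univ := Set.eq_univ_of_forall hc
    rw [hS', Real.dimH_univ_eq_finrank] at hdim
    have h2 : Module.finrank ℝ (Fin N → ℂ) = 2 * N := by
      rw [Module.finrank_pi_fintype]; simp [Complex.finrank_real_complex, mul_comm]
    rw [h2] at hdim
    have h3 : ((2 * N + 6 : ℕ) : ℝ≥0∞) ≤ ((2 * N : ℕ) : ℝ≥0∞) := by
      push_cast at hdim ⊢; exact hdim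
    have := Nat.cast_le.1 h3
    omega
  obtain ⟨z0, hz0⟩ := hne
  obtain ⟨w, Δ, hΔ, h0⟩ := hgood z0 hz0
  have hΔ0 : Δ ≠ 0 := by rintro rfl; simp at h0
  have hind : ∀ a b : PA N, a • V + b • RX N = 0 → a = 0 ∧ b = 0 := by
    intro a b hab
    have hz : ∀ z, MvPolynomial.eval z Δ ≠ 0 → MvPolynomial.eval z a = 0 ∧
        MvPolynomial.eval z b = 0 := by
      intro z hz
      rw [hΔ] at hz
      refine linind_pair Φ _ _ w hz _ _ ?_
      have := congrArg (fun Y => ev Y z) hab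
      have hX : ev (RX N) z = z := ev_X z
      simpa [hX] using this
    have ha : a * Δ = 0 := MvPolynomial.funext fun z => by
      by_cases h : MvPolynomial.eval z Δ = 0
      · simp [h]
      · simp [(hz z h).1]
    have hb : b * Δ = 0 := MvPolynomial.funext fun z => by
      by_cases h : MvPolynomial.eval z Δ = 0
      · simp [h]
      · simp [(hz z h).2]
    exact ⟨(mul_eq_zero.1 ha).resolve_right hΔ0, (mul_eq_zero.1 hb).resolve_right hΔ0⟩
  have hind2 : ∀ a b a' b' : PA N, a • V + b • RX N = a' • V + b' • RX N → a = a' ∧ b = b' := by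
    intro a b a' b' h
    have := hind (a - a') (b - b') (by
      rw [sub_smul, sub_smul]; rw [← sub_eq_zero] at h; rw [← h]; abel)
    exact ⟨sub_eq_zero.1 this.1, sub_eq_zero.1 this.2⟩
  have hcan : ∀ Y Z : Fin N → PA N, f • Y = f • Z → Y = Z := by
    intro Y Z h
    funext i
    have := congrFun h i
    simpa [hf0] using this
  obtain ⟨⟨Yf, hYf⟩, hf2⟩ := hf
  obtain ⟨⟨Yg, hYg⟩, hg2⟩ := hg
  obtain ⟨⟨Yr, hYr⟩, hr2⟩ := hr
  -- tangency to the plane gives global coefficients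
  have hA : ∀ Z : Fin N → PA N, (∀ z v, ctr Φ (ev V z) z (vecCons (ev Z z) v) = 0) →
      ∃ a b : PA N, Z = a • V + b • RX N := by
    intro Z hZ
    obtain ⟨a, b, h⟩ := hf2 Z hZ
    obtain ⟨a', b', h'⟩ := hg2 Z hZ
    have e : (g * a) • V + (g * b) • RX N = (f * a') • V + (f * b') • RX N := by
      rw [mul_smul, mul_smul, mul_smul, mul_smul, ← smul_add, ← smul_add, ← h, ← h', smul_comm]
    obtain ⟨e1, e2⟩ := hind2 _ _ _ _ e
    obtain ⟨a1, rfl⟩ := hreg2 a ⟨a', e1⟩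
    obtain ⟨b1, rfl⟩ := hreg2 b ⟨b', e2⟩
    refine ⟨a1, b1, hcan _ _ ?_⟩
    rw [h, smul_add, mul_smul, mul_smul]
  have hker : ∀ (p q : PA N) (Yp Yq : Fin N → PA N),
      (∀ z v, MvPolynomial.eval z p * ω z v = ctr Φ (ev V z) z (vecCons (ev Yp z) v)) →
      (∀ z v, MvPolynomial.eval z q * ω z v = ctr Φ (ev V z) z (vecCons (ev Yq z) v)) →
      ∃ a b : PA N, q • Yp - p • Yq = a • V + b • RX N := by
    intro p q Yp Yq hp hq
    refine hA _ fun z v => ?_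
    rw [ev_sub, ev_smul, ev_smul, ctr_cons_sub, ctr_cons_smul, ctr_cons_smul, ← hp, ← hq]
    ring
  obtain ⟨a, b, h1⟩ := hker f g Yf Yg hYf hYg
  obtain ⟨a', b', h2⟩ := hker f r Yf Yr hYf hYr
  obtain ⟨a'', b'', h3⟩ := hker g r Yg Yr hYg hYr
  have hsum : (r * a) • V + (r * b) • RX N =
      (f * (-a'') + g * a') • V + (f * (-b'') + g * b') • RX N := by
    have : r • (g • Yf - f • Yg) = g • (r • Yf - f • Yr) - f • (r • Yg - g • Yr) := by module
    rw [h1, h2, h3] at this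
    calc _ = r • (a • V + b • RX N) := by module
      _ = _ := by rw [this]; module
  obtain ⟨e1, e2⟩ := hind2 _ _ _ _ hsum
  obtain ⟨t, s, hs⟩ := hreg3 a ⟨_, _, e1⟩
  obtain ⟨t', s', hs'⟩ := hreg3 b ⟨_, _, e2⟩
  -- a = f t + g s
  have h4 : g • (Yf - s • V - s' • RX N) = f • (Yg + t • V + t' • RX N) := by
    have : g • Yf = f • Yg + (a • V + b • RX N) := by rw [← h1]; module
    rw [smul_sub, smul_sub, this, hs, hs']; module
  have hdiv : ∀ i, ∃ y, (Yf - s • V - s' • RX N) i = f * y := by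
    intro i
    have := congrFun h4 i
    exact hreg2 _ ⟨_, this⟩
  choose Y hY using hdiv
  refine ⟨Y, fun z v => ?_⟩
  obtain ⟨p, hp⟩ := hω v
  obtain ⟨q, hq⟩ := ctr_cons_poly Φ V (RX N) Y v
  have hX : ∀ z, ev (RX N) z = z := fun z => ev_X z
  simp only [hX] at hq
  have hYf' : Yf = f • Y + s • V + s' • RX N := by
    have : Yf - s • V - s' • RX N = f • Y := funext hY
    rw [← this]; abel
  have hpq : f * p = f * q := MvPolynomial.funext fun z => by
    rw [map_mul, map_mul, ← hp, hYf, hq, hYf', ev_add, ev_add, ev_smul, ev_smul, ev_smul, hX,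
      ctr_cons_add, ctr_cons_add, ctr_cons_smul, ctr_cons_smul, ctr_cons_smul,
      ctr_zero_left Φ _ _ (vecCons (ev V z) v) 0 (by simp),
      ctr_zero_right Φ _ _ (vecCons z v) 0 (by simp)]
    ring
  rw [hp, ← hq, mul_left_cancel₀ hf0 hpq]

end PolyAux

namespace HomogAux

open PolyAux

theorem homog_poly {N d : ℕ} (f : (Fin N → ℂ) → ℂ) (hf : AnalyticOnNhd ℂ f Set.univ)
    (hh : ∀ (t : ℂ) z, f (t • z) = t ^ d * f z) :
    ∃ p : PA N, ∀ z, f z = MvPolynomial.eval z p := by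
  have hcd : ContDiff ℂ d f := hf.contDiff
  set L := iteratedFDeriv ℂ d f 0 with hL
  have key : ∀ z, (d.factorial : ℂ) * f z = L (fun _ => z) := by
    intro z
    let u : ℂ →L[ℂ] (Fin N → ℂ) := ContinuousLinearMap.toSpanSingleton ℂ z
    have h1 := u.iteratedFDeriv_comp_right hcd (0 : ℂ) le_rfl
    have h2 : f ∘ u = fun t => t ^ d * f z := by
      funext t; simp [u, hh]
    have h3 : iteratedDeriv d (f ∘ u) 0 = L (fun _ => z) := by
      rw [iteratedDeriv_eq_iteratedFDeriv, h1]
      simp [u, hL]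
    rw [← h3, h2]
    have h4 : iteratedDeriv d (fun t : ℂ => t ^ d * f z) 0 =
        iteratedDeriv d (fun t : ℂ => t ^ d) 0 * f z := by
      simp
    rw [h4, iteratedDeriv_eq_iterate, iter_deriv_pow]
    simp
    left
    have h6 : ((d.descFactorial d : ℕ) : ℂ) = ∏ i ∈ Finset.range d, ((d : ℂ) - i) := by
      rw [Nat.descFactorial_eq_prod_range, Nat.cast_prod]
      refine Finset.prod_congr rfl fun i hi => ?_
      rw [Nat.cast_sub (Finset.mem_range.1 hi).le]
    rw [← h6, Nat.descFactorial_self]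
  refine ⟨MvPolynomial.C ((d.factorial : ℂ)⁻¹) * ∑ r : Fin d → Fin N,
    (∏ j, MvPolynomial.X (r j)) * MvPolynomial.C (L (fun j => Pi.single (r j) 1)), fun z => ?_⟩
  have hd : (d.factorial : ℂ) ≠ 0 := by exact_mod_cast d.factorial_ne_zero
  have hz : z = ∑ i, z i • Pi.single i (1 : ℂ) := pi_eq_sum_univ' _
  have h5 : L (fun _ => z) = ∑ r : Fin d → Fin N, (∏ j, z (r j)) * L (fun j => Pi.single (r j) 1) := by
    conv_lhs => rw [hz]
    have := L.toMultilinearMap.map_sum (fun (_ : Fin d) (i : Fin N) => z i • (Pi.single i (1 : ℂ) : Fin N → ℂ))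
    refine this.trans ?_
    refine Finset.sum_congr rfl fun r _ => ?_
    exact L.toMultilinearMap.map_smul_univ (fun j => z (r j)) (fun j => Pi.single (r j) 1)
  rw [map_mul, map_sum, MvPolynomial.eval_C]
  simp only [map_mul, map_prod, MvPolynomial.eval_X, MvPolynomial.eval_C]
  rw [← h5, ← key]
  field_simp

end HomogAux

namespace HomogAux

open PolyAux LinAux Matrix

theorem eval_homog {N e : ℕ} (p : PA N) (hp : p.IsHomogeneous e) (t : ℂ) (z : Fin N → ℂ) :
    MvPolynomial.eval (t • z) p = t ^ e * MvPolynomial.eval z p := by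
  rw [MvPolynomial.eval_eq, MvPolynomial.eval_eq, Finset.mul_sum]
  refine Finset.sum_congr rfl fun s hs => ?_
  have h1 : ∑ i ∈ s.support, s i = e := by
    have := hp (MvPolynomial.mem_support_iff.1 hs)
    rw [Finsupp.weight_apply] at this
    simpa [Finsupp.sum] using this
  simp only [Pi.smul_apply, smul_eq_mul, mul_pow, Finset.prod_mul_distrib]
  rw [Finset.prod_pow_eq_pow_sum, h1]
  ring

theorem homogenize {N m g d : ℕ} (Φ : (Fin N → ℂ) [⋀^Fin (m + 3)]→ₗ[ℂ] ℂ)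
    (V : (Fin N → ℂ) → (Fin N → ℂ)) (hV : ∀ (t : ℂ) z, V (t • z) = t ^ g • V z)
    (ω : (Fin N → ℂ) → (Fin N → ℂ) [⋀^Fin m]→ₗ[ℂ] ℂ)
    (hω : ∀ (t : ℂ) z v, ω (t • z) v = t ^ (d + 1) * ω z v)
    (Y : Fin N → PA N) (hY : ∀ z v, ω z v = ctr Φ (V z) z (vecCons (ev Y z) v)) :
    ∃ (e : ℕ) (Y' : Fin N → PA N), (∀ (t : ℂ) z, ev Y' (t • z) = t ^ e • ev Y' z) ∧
      ∀ z v, ω z v = ctr Φ (V z) z (vecCons (ev Y' z) v) := by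
  let Yc : ℕ → Fin N → PA N := fun k i => MvPolynomial.homogeneousComponent k (Y i)
  have hYc : ∀ k (t : ℂ) z, ev (Yc k) (t • z) = t ^ k • ev (Yc k) z := by
    intro k t z
    funext i
    exact eval_homog _ (MvPolynomial.homogeneousComponent_isHomogeneous k (Y i)) t z
  let K : ℕ := (∑ i, (Y i).totalDegree) + 1 + (d - g)
  have hsum : ∀ z, ev Y z = ∑ k ∈ Finset.range K, ev (Yc k) z := by
    intro z
    funext i
    rw [Finset.sum_apply]
    have h1 : ∑ k ∈ Finset.range K, MvPolynomial.homogeneousComponent k (Y i) = Y i := by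
      conv_rhs => rw [← MvPolynomial.sum_homogeneousComponent (Y i)]
      symm
      refine Finset.sum_subset ?_ ?_
      · intro k hk
        have : (Y i).totalDegree ≤ ∑ i, (Y i).totalDegree :=
          Finset.single_le_sum (f := fun i => (Y i).totalDegree) (fun _ _ => Nat.zero_le _)
            (Finset.mem_univ i)
        simp only [Finset.mem_range, K] at hk ⊢
        omega
      · intro k _ hk
        refine MvPolynomial.homogeneousComponent_eq_zero _ _ ?_
        simp only [Finset.mem_range] at hk
        omega
    calc ev Y z i = MvPolynomial.eval z (Y i) := rfl
      _ = _ := by conv_lhs => rw [← h1, map_sum]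
                  rfl
  have key : ∀ z v (t : ℂ), t ^ (d + 1) * ω z v =
      ∑ k ∈ Finset.range K, ctr Φ (V z) z (vecCons (ev (Yc k) z) v) * t ^ (g + 1 + k) := by
    intro z v t
    have hsc : ∀ (a b : ℂ) x y u, ctr Φ (a • x) (b • y) u = a * (b * ctr Φ x y u) := by
      intro a b x y u
      change (Φ.curryLeft (a • x)).curryLeft (b • y) u = a * (b * (Φ.curryLeft x).curryLeft y u)
      rw [map_smul, map_smul]
      simp
      ring
    rw [← hω, hY, hV, hsc, hsum, ← AlternatingMap.curryLeft_apply_apply, map_sum, alt_sum_apply,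
      Finset.mul_sum, Finset.mul_sum]
    refine Finset.sum_congr rfl fun k _ => ?_
    rw [hYc, AlternatingMap.curryLeft_apply_apply, ctr_cons_smul]
    ring
  have hpoly : ∀ z v, (Polynomial.C (ω z v) * Polynomial.X ^ (d + 1) : Polynomial ℂ) =
      ∑ k ∈ Finset.range K, Polynomial.C (ctr Φ (V z) z (vecCons (ev (Yc k) z) v)) *
        Polynomial.X ^ (g + 1 + k) := by
    intro z v
    refine Polynomial.funext fun t => ?_
    rw [Polynomial.eval_finsetSum]
    simp only [Polynomial.eval_mul, Polynomial.eval_C, Polynomial.eval_pow, Polynomial.eval_X]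
    rw [← key, mul_comm]
  have hcoef : ∀ z v, ω z v = ∑ k ∈ Finset.range K,
      if d + 1 = g + 1 + k then ctr Φ (V z) z (vecCons (ev (Yc k) z) v) else 0 := by
    intro z v
    have := congrArg (fun p => Polynomial.coeff p (d + 1)) (hpoly z v)
    simpa only [Polynomial.finsetSum_coeff, Polynomial.coeff_C_mul_X_pow, if_true] using this
  by_cases hgd : g ≤ d
  · refine ⟨d - g, Yc (d - g), hYc _, fun z v => ?_⟩
    rw [hcoef, Finset.sum_eq_single (d - g)]
    · rw [if_pos (by omega)]
    · intro k _ hk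
      rw [if_neg (by omega)]
    · intro h
      simp only [Finset.mem_range, K] at h
      omega
  · refine ⟨0, 0, fun t z => by simp, fun z v => ?_⟩
    rw [hcoef, ev_zero, (ctr Φ (V z) z).map_coord_zero 0 (by simp)]
    refine Finset.sum_eq_zero fun k _ => ?_
    rw [if_neg (by omega)]

end HomogAux

namespace FinalAux

open PolyAux LinAux Matrix

theorem append_cons {α : Type*} {m : ℕ} (a b c : α) (v : Fin m → α) (h : m + 3 = 3 + m)
    (k : Fin (m + 3)) :
    Fin.append ![a, b, c] v (Fin.cast h k) = vecCons a (vecCons b (vecCons c v)) k := by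
  refine Fin.cases ?_ (fun k => Fin.cases ?_ (fun k => Fin.cases ?_ (fun k => ?_) k) k) k
  · have : Fin.cast h 0 = Fin.castAdd m (0 : Fin 3) := by ext; simp
    rw [this, Fin.append_left]; rfl
  · have : Fin.cast h (Fin.succ 0) = Fin.castAdd m (1 : Fin 3) := by ext; simp
    rw [this, Fin.append_left]; rfl
  · have : Fin.cast h (Fin.succ (Fin.succ 0)) = Fin.castAdd m (2 : Fin 3) := by ext; simp
    rw [this, Fin.append_left]; rfl
  · have : Fin.cast h k.succ.succ.succ = Fin.natAdd 3 k := by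
      ext
      simp only [Fin.val_cast, Fin.val_succ, Fin.val_natAdd]
      omega
    rw [this, Fin.append_right]; rfl

/-- the volume form -/
noncomputable def vol {N m : ℕ} (hN : N = m + 3) : (Fin N → ℂ) [⋀^Fin (m + 3)]→ₗ[ℂ] ℂ :=
  (Matrix.detRowAlternating : (Fin N → ℂ) [⋀^Fin N]→ₗ[ℂ] ℂ).domDomCongr (finCongr hN)

theorem vol_apply {N m : ℕ} (hN : N = m + 3) (u : Fin (m + 3) → (Fin N → ℂ)) :
    vol hN u = Matrix.det (Matrix.of fun i j => u (Fin.cast hN i) j) := rfl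

theorem vol_ne {N m : ℕ} (hN : N = m + 3) : vol hN ≠ 0 := by
  intro h
  have h1 : vol hN (fun k => Pi.single (Fin.cast hN.symm k) 1) = 0 := by rw [h]; rfl
  rw [vol_apply] at h1
  have h2 : (Matrix.of fun i j => (Pi.single (Fin.cast hN.symm (Fin.cast hN i)) 1 : Fin N → ℂ) j)
      = (1 : Matrix (Fin N) (Fin N) ℂ) := by
    ext i j
    simp [Matrix.one_apply, Pi.single_apply, eq_comm]
  rw [h2] at h1
  simp at h1

theorem vol_swap {N m : ℕ} (Φ : (Fin N → ℂ) [⋀^Fin (m + 3)]→ₗ[ℂ] ℂ) (a b c : Fin N → ℂ)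
    (v : Fin m → (Fin N → ℂ)) :
    Φ (vecCons a (vecCons b (vecCons c v))) = - Φ (vecCons a (vecCons c (vecCons b v))) := by
  have h := (Φ.curryLeft a).map_swap (vecCons c (vecCons b v))
    (i := 0) (j := (0 : Fin (m + 1)).succ) (Fin.succ_ne_zero _).symm
  have e : (vecCons c (vecCons b v)) ∘ (Equiv.swap 0 (0 : Fin (m + 1)).succ) =
      vecCons b (vecCons c v) := by
    funext k
    refine Fin.cases ?_ (fun k => Fin.cases ?_ (fun k => ?_) k) k
    · simp
    · simp
    · rw [Function.comp_apply, Equiv.swap_apply_of_ne_of_ne (Fin.succ_ne_zero _)]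
      · rfl
      · intro h
        exact Fin.succ_ne_zero k (Fin.succ_injective _ h)
  rw [e] at h
  exact h

theorem vol_swap_first {N m : ℕ} (Φ : (Fin N → ℂ) [⋀^Fin (m + 3)]→ₗ[ℂ] ℂ) (a b : Fin N → ℂ)
    (u : Fin (m + 1) → (Fin N → ℂ)) :
    Φ (vecCons a (vecCons b u)) = - Φ (vecCons b (vecCons a u)) := by
  have h := Φ.map_swap (vecCons b (vecCons a u))
    (i := 0) (j := (0 : Fin (m + 2)).succ) (Fin.succ_ne_zero _).symm
  have e : (vecCons b (vecCons a u)) ∘ (Equiv.swap 0 (0 : Fin (m + 2)).succ) =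
      vecCons a (vecCons b u) := by
    funext k
    refine Fin.cases ?_ (fun k => Fin.cases ?_ (fun k => ?_) k) k
    · simp
    · simp
    · rw [Function.comp_apply, Equiv.swap_apply_of_ne_of_ne (Fin.succ_ne_zero _)]
      · rfl
      · intro h
        exact Fin.succ_ne_zero k (Fin.succ_injective _ h)
  rw [e] at h
  exact h

theorem analytic_eval {N : ℕ} (p : PA N) (q : Fin N → ℂ) :
    AnalyticAt ℂ (fun z => MvPolynomial.eval z p) q := by
  induction p using MvPolynomial.induction_on with
  | C a => simpa using analyticAt_const
  | add p q hp hq =>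
    simp only [map_add]
    exact hp.add hq
  | mul_X p i hp =>
    have : AnalyticAt ℂ (fun z : Fin N → ℂ => z i) q :=
      (ContinuousLinearMap.proj (R := ℂ) (φ := fun _ : Fin N => ℂ) i).analyticAt q
    simp only [map_mul, MvPolynomial.eval_X]
    exact hp.mul this

theorem analytic_ev {N : ℕ} (Y : Fin N → PA N) (q : Fin N → ℂ) :
    AnalyticAt ℂ (fun z => ev Y z) q :=
  AnalyticAt.pi fun i => analytic_eval (Y i) q

end FinalAux

/-- Corollary 3.7: Let `D` be a two-dimensional distribution on `ℙⁿ`,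
`n ≥ 3`, and `G` a one-dimensional foliation tangent to `D`. If `codim sing G ≥ 3`
then `G` locally divides `D` at every point; in particular `T_D` splits. -/
theorem statement_6 (n : ℕ) (hn : 3 ≤ n) (D : ProjDist n 2) (G : ProjFol1 n)
    (htan : PTangent G D) (hcodim : CodimGE (n + 1) G.coneSing 3) :
    (∀ q : Cn (n + 1), q ≠ 0 → PLocDividesAt G D q) ∧ PSplits (by omega) D := by
  have hN : n + 1 = (n - 2) + 3 := by omega
  -- polynomial data
  have hVp : ∀ i, ∃ p : PolyAux.PA (n + 1), ∀ z, G.V z i = MvPolynomial.eval z p := by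
    intro i
    refine HomogAux.homog_poly (d := G.d) (fun z => G.V z i) ?_ ?_
    · intro z hz
      exact ((ContinuousLinearMap.proj (R := ℂ) (φ := fun _ : Fin (n + 1) => ℂ) i).analyticAt
        (G.V z)).comp (G.hol z hz)
    · intro t z
      rw [G.homog]; rfl
  choose V hVe using hVp
  have hV : ∀ z, PolyAux.ev V z = G.V z := fun z => funext fun i => (hVe i z).symm
  have hω : ∀ v, ∃ p : PolyAux.PA (n + 1), ∀ z, D.ω z v = MvPolynomial.eval z p := by
    intro v
    exact HomogAux.homog_poly (d := D.d + 1) (fun z => D.ω z v) (D.hol v) (fun t z => D.homog t z v)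
  have hdim : dimH (G.coneSing ∪ {0}) + 6 ≤ 2 * ((n + 1 : ℕ) : ℝ≥0∞) := by
    have e6 : (2 : ℝ≥0∞) * ((3 : ℕ) : ℝ≥0∞) = 6 := by norm_num
    rw [dimH_union, dimH_singleton]
    rcases hcodim with h | h
    · rw [h, dimH_empty]
      have : ((6 : ℕ) : ℝ≥0∞) ≤ ((2 * (n + 1) : ℕ) : ℝ≥0∞) := Nat.cast_le.2 (by omega)
      push_cast at this ⊢
      simpa using this
    · rw [e6] at h
      simpa using h
  obtain ⟨Y0, hY0⟩ := PolyAux.main_poly hN (FinalAux.vol hN) (FinalAux.vol_ne hN) V D.ω hω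
    (fun z v i h => htan z v i (by rw [h, hV])) (fun z v i h => D.radial z v i h)
    (G.coneSing ∪ {0}) (by
      intro z hz
      have hz0 : z ≠ 0 := fun h => hz (Or.inr h)
      have hzs : G.V z ∉ Submodule.span ℂ {z} := fun h => hz (Or.inl ⟨hz0, h⟩)
      rw [hV, LinearIndependent.pair_iff]
      intro s t hst
      have hs : s = 0 := by
        by_contra hs
        apply hzs
        rw [Submodule.mem_span_singleton]
        refine ⟨-(s⁻¹ * t), ?_⟩
        have h1 : s⁻¹ • (s • G.V z + t • z) = 0 := by rw [hst, smul_zero]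
        rw [smul_add, smul_smul, inv_mul_cancel₀ hs, one_smul, smul_smul] at h1
        rw [neg_smul]
        exact (eq_neg_of_add_eq_zero_left h1).symm
      refine ⟨hs, ?_⟩
      rw [hs, zero_smul, zero_add] at hst
      exact (smul_eq_zero.1 hst).resolve_right hz0) hdim
  simp only [hV] at hY0
  obtain ⟨e, Y, hYh, hY⟩ := HomogAux.homogenize (FinalAux.vol hN) G.V G.homog D.ω D.homog Y0 hY0
  refine ⟨fun q _ => ?_, ?_⟩
  · refine ⟨fun z => (FinalAux.vol hN).curryLeft (PolyAux.ev Y z), ?_, ?_⟩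
    · intro v
      let L : (Fin (n + 1) → ℂ) →ₗ[ℂ] ℂ :=
        { toFun := fun y => (FinalAux.vol hN).curryLeft y v
          map_add' := fun x y => by simp only [map_add, AlternatingMap.add_apply]
          map_smul' := fun c x => by simp only [map_smul, AlternatingMap.smul_apply,
            RingHom.id_apply] }
      have hL := (LinearMap.toContinuousLinearMap L).analyticAt (PolyAux.ev Y q)
      exact hL.comp (FinalAux.analytic_ev Y q)
    · refine Filter.Eventually.of_forall fun z v => ?_
      rw [hY, LinAux.ctr_apply, FinalAux.vol_swap, FinalAux.vol_swap_first, neg_neg]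
      rfl
  · refine ⟨G.V, fun z => PolyAux.ev Y z, G.d, e, -1, by norm_num, G.hol,
      fun q _ => FinalAux.analytic_ev Y q, G.homog, hYh, fun z v => ?_⟩
    rw [hY, LinAux.ctr_apply, FinalAux.vol_swap, FinalAux.vol_apply, neg_one_mul]
    congr 3
    funext i j
    rw [← FinalAux.append_cons _ _ _ _ (by omega)]
    rfl
end

section
/- Let D be a two-dimensional singular holomorphic distribution on ℙ^n, n ≥ 3, and let G be a one-dimensional foliation on ℙ^n tangent to D. If G locally divides D, then deg(G) ≤ deg(D). In particular, if codim(sing(G)) ≥ 3 then deg(G) ≤ deg(D). -/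
open Topology Filter Set
open scoped ENNReal Manifold

namespace S7
variable {S E : Type*} [CommRing S] [AddCommGroup E] [Module S E]

/-- wedge with a one-form -/
noncomputable def wed {n : ℕ} (l : E →ₗ[S] S) : (E [⋀^Fin n]→ₗ[S] S) →ₗ[S] (E [⋀^Fin (n+1)]→ₗ[S] S) where
  toFun w := AlternatingMap.alternatizeUncurryFin (l.smulRight w)
  map_add' a b := by
    rw [← AlternatingMap.alternatizeUncurryFin_add]; congr 1; ext; simp
  map_smul' c a := by
    rw [RingHom.id_apply, ← AlternatingMap.alternatizeUncurryFin_smul]; congr 1; ext; simp; ring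

/-- contraction -/
noncomputable def con {n : ℕ} (X : E) : (E [⋀^Fin (n+1)]→ₗ[S] S) →ₗ[S] (E [⋀^Fin n]→ₗ[S] S) where
  toFun w := w.curryLeft X
  map_add' a b := by ext; simp
  map_smul' c a := by ext; simp

lemma con_apply {n : ℕ} (X : E) (w : E [⋀^Fin (n+1)]→ₗ[S] S) (v : Fin n → E) :
    con X w v = w (Fin.cons X v) := rfl

lemma con_wed {n : ℕ} (l : E →ₗ[S] S) (X : E) (w : E [⋀^Fin (n+1)]→ₗ[S] S) :
    con X (wed l w) = l X • w - wed l (con X w) := by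
  ext v
  simp only [con, wed, LinearMap.coe_mk, AddHom.coe_mk, AlternatingMap.curryLeft_apply_apply,
    AlternatingMap.alternatizeUncurryFin_apply, AlternatingMap.sub_apply, AlternatingMap.smul_apply,
    LinearMap.smulRight_apply]
  rw [Fin.sum_univ_succ]
  simp only [Matrix.vecCons, Fin.cons_zero, Fin.cons_succ, Fin.val_zero, pow_zero, one_smul,
    Fin.val_succ, sub_eq_add_neg]
  congr 1
  rw [← Finset.sum_neg_distrib]
  refine Finset.sum_congr rfl fun i _ => ?_
  have : i.succ.removeNth (Fin.cons X v : Fin (n+2) → E) = Fin.cons X (i.removeNth v) := by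
    ext j
    refine Fin.cases ?_ (fun j => ?_) j <;> simp [Fin.removeNth]
  rw [this, pow_succ]
  simp

variable {r : ℕ}
abbrev dx (r : ℕ) (S : Type*) [CommRing S] (i : Fin r) : (Fin r → S) →ₗ[S] S := LinearMap.proj i

noncomputable abbrev vol (r : ℕ) (S : Type*) [CommRing S] : (Fin r → S) [⋀^Fin r]→ₗ[S] S := (Pi.basisFun S (Fin r)).det

lemma F3 {n N : ℕ} (V R : Fin N → S) (w : (Fin N → S) [⋀^Fin (n+1)]→ₗ[S] S)
    (hV : con V w = 0) (hR : con R w = 0) (i j : Fin N) :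
    con R (con V (wed (dx N S i) (wed (dx N S j) w))) = (V i * R j - V j * R i) • w := by
  simp only [con_wed, map_sub, map_smul, hV, hR, map_zero, sub_zero, dx, LinearMap.proj_apply, smul_smul]
  ext v
  simp only [AlternatingMap.sub_apply, AlternatingMap.smul_apply, smul_eq_mul]
  ring

lemma F2' {n : ℕ} (V R : Fin (n+3) → S) (T : (Fin (n+3) → S) [⋀^Fin (n+2)]→ₗ[S] S)
    (h : con R (con V T) = 0) (i j : Fin (n+3)) :
    ∃ s t : S, (V j * R i - V i * R j) • T = s • con R (vol (n+3) S) + t • con V (vol (n+3) S) := by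
  obtain ⟨a, ha⟩ : ∃ a, wed (dx _ S i) T = a • vol (n+3) S := ⟨_, AlternatingMap.eq_smul_basis_det _ _⟩
  obtain ⟨b, hb⟩ : ∃ a, wed (dx _ S j) T = a • vol (n+3) S := ⟨_, AlternatingMap.eq_smul_basis_det _ _⟩
  obtain ⟨s, hs⟩ : ∃ a, wed (dx _ S i) (wed (dx _ S j) (con V T)) = a • vol (n+3) S := ⟨_, AlternatingMap.eq_smul_basis_det _ _⟩
  have ha' := congrArg (con V) ha
  have hb' := congrArg (con V) hb
  have hs' := congrArg (con R) hs
  simp only [con_wed, map_smul, h, map_zero, sub_zero, dx, LinearMap.proj_apply] at ha' hb' hs'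
  refine ⟨s, R i * b - R j * a, ?_⟩
  ext v
  have h1 := DFunLike.congr_fun ha' v
  have h2 := DFunLike.congr_fun hb' v
  have h3 := DFunLike.congr_fun hs' v
  simp only [AlternatingMap.sub_apply, AlternatingMap.add_apply, AlternatingMap.smul_apply, smul_eq_mul] at *
  linear_combination h3 + R i * h2 - R j * h1

lemma vol_con_inj {n : ℕ} (X : Fin (n+1) → S) (h : con X (vol (n+1) S) = 0) : X = 0 := by
  ext k
  have h1 : vol (n+1) S (k.insertNth X (k.removeNth (Pi.basisFun S (Fin (n+1))))) = 0 := by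
    rw [AlternatingMap.map_insertNth]
    have := DFunLike.congr_fun h (k.removeNth (Pi.basisFun S (Fin (n+1))))
    rw [con_apply] at this
    rw [Matrix.vecCons, this]; simp
  rw [Fin.insertNth_removeNth] at h1
  rw [Module.Basis.det_apply] at h1
  have h2 : (Pi.basisFun S (Fin (n+1))).toMatrix (Function.update (Pi.basisFun S (Fin (n+1))) k X) = (1 : Matrix _ _ S).updateCol k X := by
    ext a b
    by_cases hb : b = k
    · subst hb; simp [Module.Basis.toMatrix_apply]
    · simp [Module.Basis.toMatrix_apply, hb, Matrix.one_apply, Pi.single_apply]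
  rw [h2, ← Matrix.cramer_apply] at h1
  simpa using h1


/-- ideal of the minors -/
def minI {N : ℕ} (V R : Fin N → S) : Ideal S :=
  Ideal.span (Set.range fun p : Fin N × Fin N => V p.1 * R p.2 - V p.2 * R p.1)

lemma min_mul {n : ℕ} (V R : Fin (n+3) → S) (T : (Fin (n+3) → S) [⋀^Fin (n+2)]→ₗ[S] S)
    (h : con R (con V T) = 0) (u : S) (hu : u ∈ minI V R) :
    ∃ s t : S, ∀ v, u * T v = s * con R (vol (n+3) S) v + t * con V (vol (n+3) S) v := by
  induction hu using Submodule.span_induction with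
  | mem x hx =>
    obtain ⟨⟨i, j⟩, rfl⟩ := hx
    obtain ⟨s, t, hst⟩ := F2' V R T h j i
    exact ⟨s, t, fun v => by simpa using DFunLike.congr_fun hst v⟩
  | zero => exact ⟨0, 0, fun v => by simp⟩
  | add x y _ _ hx hy =>
    obtain ⟨s, t, h1⟩ := hx
    obtain ⟨s', t', h2⟩ := hy
    exact ⟨s + s', t + t', fun v => by linear_combination h1 v + h2 v⟩
  | smul a x _ hx =>
    obtain ⟨s, t, h1⟩ := hx
    exact ⟨a * s, a * t, fun v => by rw [smul_eq_mul]; linear_combination a * h1 v⟩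

lemma indep [IsDomain S] {n : ℕ} (V R : Fin (n+3) → S) (u : S) (hu : u ∈ minI V R) (hu0 : u ≠ 0)
    (a b : S) (h : ∀ v, a * con R (vol (n+3) S) v + b * con V (vol (n+3) S) v = 0) : a = 0 ∧ b = 0 := by
  have h1 : con (a • R + b • V) (vol (n+3) S) = 0 := by
    ext v
    have := h v
    simp only [con, LinearMap.coe_mk, AddHom.coe_mk] at this ⊢
    simpa using this
  have h2 := vol_con_inj _ h1
  have h3 : ∀ i, a * R i + b * V i = 0 := fun i => by simpa using congrFun h2 i
  have key : ∀ u ∈ minI V R, a * u = 0 ∧ b * u = 0 := by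
    intro u hu
    induction hu using Submodule.span_induction with
    | mem x hx =>
      obtain ⟨⟨i, j⟩, rfl⟩ := hx
      constructor
      · linear_combination V i * h3 j - V j * h3 i
      · linear_combination R j * h3 i - R i * h3 j
    | zero => simp
    | add x y _ _ hx hy => exact ⟨by linear_combination hx.1 + hy.1, by linear_combination hx.2 + hy.2⟩
    | smul c x _ hx => rw [smul_eq_mul]; exact ⟨by linear_combination c * hx.1, by linear_combination c * hx.2⟩
  have := key u hu
  simpa [hu0] using this

lemma ker_div [IsDomain S] {n : ℕ} (V R : Fin (n+3) → S)
    (g u1 u2 : S) (hu1 : g * u1 ∈ minI V R) (hu2 : g * u2 ∈ minI V R) (h0 : g * u1 ≠ 0)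
    (hrel : ∀ x, u1 ∣ u2 * x → u1 ∣ x) (T : (Fin (n+3) → S) [⋀^Fin (n+2)]→ₗ[S] S)
    (h : con R (con V T) = 0) :
    ∃ s t : S, ∀ v, g * T v = s * con R (vol (n+3) S) v + t * con V (vol (n+3) S) v := by
  obtain ⟨s1, t1, h1⟩ := min_mul V R T h _ hu1
  obtain ⟨s2, t2, h2⟩ := min_mul V R T h _ hu2
  have hu10 : u1 ≠ 0 := right_ne_zero_of_mul h0
  obtain ⟨e1, e2⟩ := indep V R _ hu1 h0 (u2 * s1 - u1 * s2) (u2 * t1 - u1 * t2) (fun v => by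
    linear_combination u1 * h2 v - u2 * h1 v)
  obtain ⟨s, rfl⟩ := hrel s1 ⟨s2, by linear_combination e1⟩
  obtain ⟨t, rfl⟩ := hrel t1 ⟨t2, by linear_combination e2⟩
  exact ⟨s, t, fun v => mul_left_cancel₀ hu10 (by linear_combination h1 v)⟩

/-- gluing -/
lemma glue [IsDomain S] {n : ℕ} (V R : Fin (n+3) → S)
    (g u1 u2 : S) (hu1 : g * u1 ∈ minI V R) (hu2 : g * u2 ∈ minI V R) (h0 : g * u1 ≠ 0)
    (hrel : ∀ x, u1 ∣ u2 * x → u1 ∣ x) (X0 X1 X2 : S)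
    (hX1 : ∀ y, X0 ∣ X1 * y → X0 ∣ y)
    (hX2 : ∀ y, (∃ a b, X2 * y = a * X0 + b * X1) → ∃ a b, y = a * X0 + b * X1)
    (w : (Fin (n+3) → S) [⋀^Fin n]→ₗ[S] S)
    (T0 T1 T2 : (Fin (n+3) → S) [⋀^Fin (n+2)]→ₗ[S] S)
    (h1 : X0 • w = con R (con V T0)) (h2 : X1 • w = con R (con V T1)) (h3 : X2 • w = con R (con V T2)) :
    ∃ T' : (Fin (n+3) → S) [⋀^Fin (n+2)]→ₗ[S] S, (g * X0) • w = con R (con V T') ∧ ∀ v, X0 ∣ T' v := by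
  have k01 : con R (con V (X1 • T0 - X0 • T1)) = 0 := by
    simp only [map_sub, map_smul, ← h1, ← h2, smul_smul, mul_comm, sub_self]
  have k02 : con R (con V (X2 • T0 - X0 • T2)) = 0 := by
    simp only [map_sub, map_smul, ← h1, ← h3, smul_smul, mul_comm, sub_self]
  have k12 : con R (con V (X2 • T1 - X1 • T2)) = 0 := by
    simp only [map_sub, map_smul, ← h2, ← h3, smul_smul, mul_comm, sub_self]
  obtain ⟨s01, t01, e01⟩ := ker_div V R g u1 u2 hu1 hu2 h0 hrel _ k01
  obtain ⟨s02, t02, e02⟩ := ker_div V R g u1 u2 hu1 hu2 h0 hrel _ k02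
  obtain ⟨s12, t12, e12⟩ := ker_div V R g u1 u2 hu1 hu2 h0 hrel _ k12
  simp only [AlternatingMap.sub_apply, AlternatingMap.smul_apply, smul_eq_mul] at e01 e02 e12
  obtain ⟨c1, c2⟩ := indep V R _ hu1 h0 (X2 * s01 - X1 * s02 + X0 * s12) (X2 * t01 - X1 * t02 + X0 * t12)
    (fun v => by linear_combination -X2 * e01 v + X1 * e02 v - X0 * e12 v)
  obtain ⟨p, a, hp⟩ := hX2 s01 ⟨-s12, s02, by linear_combination c1⟩
  obtain ⟨q, b, hq⟩ := hX2 t01 ⟨-t12, t02, by linear_combination c2⟩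
  refine ⟨g • T0 - a • con R (vol (n+3) S) - b • con V (vol (n+3) S), ?_, fun v => ?_⟩
  · have z1 : con R (con V (con R (vol (n+3) S))) = 0 := by
      ext v
      simp only [con_apply]
      exact AlternatingMap.map_eq_zero_of_eq _ _ (i := 0) (j := (1 : Fin (n+2)).succ) rfl (Fin.succ_ne_zero _).symm
    have z2 : con R (con V (con V (vol (n+3) S))) = 0 := by
      ext v
      simp only [con_apply]
      exact AlternatingMap.map_eq_zero_of_eq _ _ (i := 0) (j := 1) rfl (by simp)
    simp only [map_sub, map_smul, z1, z2, smul_zero, sub_zero, mul_smul, h1]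
  · apply hX1
    simp only [AlternatingMap.sub_apply, AlternatingMap.smul_apply, smul_eq_mul]
    exact ⟨g * T1 v + p * con R (vol (n+3) S) v + q * con V (vol (n+3) S) v, by
      subst hp hq; linear_combination e01 v⟩

end S7

namespace S7
abbrev P3 := MvPolynomial (Fin 3) ℂ
noncomputable abbrev m3 : Ideal P3 := MvPolynomial.idealOfVars (Fin 3) ℂ

lemma pow_mem (I : Ideal P3) (h : ∀ q : Fin 3 → ℂ, q ≠ 0 → ∃ f ∈ I, MvPolynomial.eval q f ≠ 0)
    (i : Fin 3) : ∃ k, (MvPolynomial.X i : P3) ^ k ∈ I := by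
  have h1 : (MvPolynomial.X i : P3) ∈ I.radical := by
    rw [← MvPolynomial.vanishingIdeal_zeroLocus_eq_radical (K := ℂ)]
    intro x hx
    have : x = 0 := by
      by_contra hx0
      obtain ⟨f, hf, hf'⟩ := h x hx0
      exact hf' (by simpa [MvPolynomial.coe_aeval_eq_eval] using hx f hf)
    simp [this]
  exact h1

lemma relprime_pow (i j : Fin 3) (hij : i ≠ j) (a b : ℕ) :
    IsRelPrime ((MvPolynomial.X i : P3) ^ a) ((MvPolynomial.X j : P3) ^ b) := by
  refine IsRelPrime.pow ?_
  rw [(MvPolynomial.X_prime).irreducible.isRelPrime_iff_not_dvd]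
  rw [MvPolynomial.X_dvd_X]
  exact hij

lemma reg3 (k : ℕ) (y : P3) (h : ∃ a b : P3, (MvPolynomial.X 2) ^ k * y = a * (MvPolynomial.X 0) ^ k + b * (MvPolynomial.X 1) ^ k) :
    ∃ a b : P3, y = a * (MvPolynomial.X 0) ^ k + b * (MvPolynomial.X 1) ^ k := by
  have key : ∀ y : P3, (∃ a b : P3, y = a * (MvPolynomial.X 0) ^ k + b * (MvPolynomial.X 1) ^ k) ↔
      ∀ xi ∈ y.support, k ≤ xi 0 ∨ k ≤ xi 1 := by
    intro y
    have := MvPolynomial.mem_ideal_span_monomial_image (x := y) (s := {Finsupp.single (0 : Fin 3) k, Finsupp.single 1 k})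
    rw [Set.image_pair, Ideal.mem_span_pair] at this
    simp only [Set.mem_insert_iff, Set.mem_singleton_iff, exists_eq_or_imp, exists_eq_left,
      Finsupp.single_le_iff] at this
    rw [← this]
    simp only [MvPolynomial.X_pow_eq_monomial, eq_comm]
  rw [key] at h ⊢
  intro xi hxi
  have := h (Finsupp.single 2 k + xi) (by
    rw [MvPolynomial.mem_support_iff] at hxi ⊢
    rw [MvPolynomial.X_pow_eq_monomial, MvPolynomial.coeff_monomial_mul, one_mul]
    exact hxi)
  simpa using this

lemma alt_sum_apply {S E ι : Type*} [CommRing S] [AddCommGroup E] [Module S E] {n : ℕ} (s : Finset ι)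
    (f : ι → E [⋀^Fin n]→ₗ[S] S) (v : Fin n → E) : (∑ i ∈ s, f i) v = ∑ i ∈ s, f i v := by
  classical
  induction s using Finset.induction_on with
  | empty => simp
  | insert a s ha ih => rw [Finset.sum_insert ha, Finset.sum_insert ha, AlternatingMap.add_apply, ih]

/-- divisor ideal -/
def dIdeal {S E : Type*} [CommRing S] [AddCommGroup E] [Module S E] {n : ℕ} (V R : E) (w : E [⋀^Fin n]→ₗ[S] S) : Ideal S where
  carrier := {f | ∃ T : E [⋀^Fin (n+2)]→ₗ[S] S, f • w = con R (con V T)}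
  add_mem' := by
    rintro a b ⟨T, hT⟩ ⟨T', hT'⟩
    refine ⟨T + T', ?_⟩
    rw [map_add, map_add, ← hT, ← hT']
    ext v; simp; ring
  zero_mem' := ⟨0, by ext v; simp⟩
  smul_mem' := by
    rintro c a ⟨T, hT⟩
    refine ⟨c • T, ?_⟩
    rw [map_smul, map_smul, ← hT]
    ext v; simp; ring

lemma core {n e : ℕ} (V R : Fin (n+3) → P3) (w : (Fin (n+3) → P3) [⋀^Fin n]→ₗ[P3] P3)
    (h1 : ∀ q : Fin 3 → ℂ, q ≠ 0 → ∃ f ∈ dIdeal V R w, MvPolynomial.eval q f ≠ 0)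
    (h2 : ∀ q : Fin 3 → ℂ, q ≠ 0 → q 2 = 0 → ∃ f ∈ minI V R, MvPolynomial.eval q f ≠ 0)
    (hV : ∀ i, V i ∈ m3 ^ e) (hR : ∀ i, R i ∈ m3) (v : Fin n → Fin (n+3) → P3) :
    w v ∈ m3 ^ (e + 1) := by
  obtain ⟨k0, hk0⟩ := pow_mem _ h1 0
  obtain ⟨k1, hk1⟩ := pow_mem _ h1 1
  obtain ⟨k2, hk2⟩ := pow_mem _ h1 2
  obtain ⟨T0, hT0⟩ := Ideal.pow_mem_of_pow_mem (n := k0 + k1 + k2) _ hk0 (by omega)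
  obtain ⟨T1, hT1⟩ := Ideal.pow_mem_of_pow_mem (n := k0 + k1 + k2) _ hk1 (by omega)
  obtain ⟨T2, hT2⟩ := Ideal.pow_mem_of_pow_mem (n := k0 + k1 + k2) _ hk2 (by omega)
  set k := k0 + k1 + k2
  have h2' : ∀ q : Fin 3 → ℂ, q ≠ 0 → ∃ f ∈ minI V R ⊔ Ideal.span {(MvPolynomial.X 2 : P3)}, MvPolynomial.eval q f ≠ 0 := by
    intro q hq
    by_cases hq2 : q 2 = 0
    · obtain ⟨f, hf, hf'⟩ := h2 q hq hq2
      exact ⟨f, Ideal.mem_sup_left hf, hf'⟩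
    · exact ⟨MvPolynomial.X 2, Ideal.mem_sup_right (Ideal.mem_span_singleton_self _), by simpa using hq2⟩
  obtain ⟨l0, hl0⟩ := pow_mem _ h2' 0
  obtain ⟨l1, hl1⟩ := pow_mem _ h2' 1
  obtain ⟨u1, hu1, y1, hy1, e1⟩ := Submodule.mem_sup.1 hl0
  obtain ⟨u2, hu2, y2, hy2, e2⟩ := Submodule.mem_sup.1 hl1
  rw [Ideal.mem_span_singleton] at hy1 hy2
  obtain ⟨z1, rfl⟩ := hy1
  obtain ⟨z2, rfl⟩ := hy2
  have hu10 : u1 ≠ 0 := by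
    rintro rfl
    have := congrArg (MvPolynomial.eval ![1,0,0]) e1
    simp at this
  obtain ⟨u1', u2', g, hrel, hg1, hg2⟩ := UniqueFactorizationMonoid.exists_reduced_factors u1 hu10 u2
  have hg0 : MvPolynomial.eval 0 g ≠ 0 := by
    let φ : P3 →ₐ[ℂ] P3 := MvPolynomial.aeval ![MvPolynomial.X 0, MvPolynomial.X 1, 0]
    have a1 : φ g ∣ (MvPolynomial.X 0) ^ l0 := by
      refine ⟨φ u1', ?_⟩
      have := congrArg φ e1
      rw [← hg1] at this
      simp [φ] at this
      exact this.symm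
    have a2 : φ g ∣ (MvPolynomial.X 1) ^ l1 := by
      refine ⟨φ u2', ?_⟩
      have := congrArg φ e2
      rw [← hg2] at this
      simp [φ] at this
      exact this.symm
    have a3 : IsUnit (φ g) := relprime_pow 0 1 (by decide) _ _ a1 a2
    have a4 : MvPolynomial.eval 0 (φ g) = MvPolynomial.eval 0 g := by
      have : (MvPolynomial.aeval (0 : Fin 3 → ℂ)).comp φ = MvPolynomial.aeval (0 : Fin 3 → ℂ) := by
        apply MvPolynomial.algHom_ext
        intro i
        fin_cases i <;> simp [φ]
      have := DFunLike.congr_fun this g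
      simpa [MvPolynomial.coe_aeval_eq_eval] using this
    rw [← a4]
    exact (a3.map (MvPolynomial.eval (0 : Fin 3 → ℂ))).ne_zero
  obtain ⟨T', hT', hdiv⟩ := glue V R g u1' u2' (hg1 ▸ hu1) (hg2 ▸ hu2) (hg1 ▸ hu10)
    (fun x hx => hrel.dvd_of_dvd_mul_left hx)
    ((MvPolynomial.X 0) ^ k) ((MvPolynomial.X 1) ^ k) ((MvPolynomial.X 2) ^ k)
    (fun y hy => (relprime_pow 0 1 (by decide) _ _).dvd_of_dvd_mul_left hy)
    (reg3 k) w T0 T1 T2 hT0 hT1 hT2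
  have hgw : g * w v ∈ m3 ^ (e + 1) := by
    have b1 := DFunLike.congr_fun hT' v
    have b2 : con R (con V T') v = ∑ a, ∑ b, V a * R b * T' (Fin.cons (Pi.single a 1) (Fin.cons (Pi.single b 1) v)) := by
      have cV : con V T' = ∑ a, V a • con (Pi.single a 1) T' := by
        have : V = ∑ a, V a • (Pi.single a 1 : Fin (n+3) → P3) := by
          ext j; simp [Finset.sum_apply, Pi.single_apply]
        conv_lhs => rw [this]
        simp only [con, LinearMap.coe_mk, AddHom.coe_mk, map_sum, map_smul]
      have cR : ∀ U : (Fin (n+3) → P3) [⋀^Fin (n+1)]→ₗ[P3] P3, con R U = ∑ a, R a • con (Pi.single a 1) U := by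
        intro U
        have : R = ∑ a, R a • (Pi.single a 1 : Fin (n+3) → P3) := by
          ext j; simp [Finset.sum_apply, Pi.single_apply]
        conv_lhs => rw [this]
        simp only [con, LinearMap.coe_mk, AddHom.coe_mk, map_sum, map_smul]
      rw [cV, map_sum, alt_sum_apply]
      refine Finset.sum_congr rfl fun a _ => ?_
      rw [map_smul, cR, AlternatingMap.smul_apply, alt_sum_apply, Finset.smul_sum]
      refine Finset.sum_congr rfl fun b _ => ?_
      rw [AlternatingMap.smul_apply, con_apply, con_apply, smul_eq_mul, smul_eq_mul, mul_assoc]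
    choose c hc using hdiv
    rw [b2] at b1
    simp only [hc, AlternatingMap.smul_apply, smul_eq_mul] at b1
    have b3 : g * w v = ∑ a, ∑ b, V a * R b * c (Fin.cons (Pi.single a 1) (Fin.cons (Pi.single b 1) v)) := by
      apply mul_left_cancel₀ (pow_ne_zero k (MvPolynomial.X_ne_zero (R := ℂ) (0 : Fin 3)))
      rw [Finset.mul_sum]
      simp only [Finset.mul_sum]
      calc _ = _ := by ring
        _ = _ := b1
        _ = _ := by
          refine Finset.sum_congr rfl fun a _ => Finset.sum_congr rfl fun b _ => by ring
    rw [b3]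
    refine Ideal.sum_mem _ fun a _ => Ideal.sum_mem _ fun b _ => Ideal.mul_mem_right _ _ ?_
    rw [pow_succ]
    exact Ideal.mul_mem_mul (hV a) (hR b)
  have hcop : IsCoprime (Ideal.span {g}) m3 := by
    rw [Ideal.isCoprime_iff_exists]
    refine ⟨MvPolynomial.C (MvPolynomial.eval 0 g)⁻¹ * g, Ideal.mul_mem_left _ _ (Ideal.mem_span_singleton_self _),
      1 - MvPolynomial.C (MvPolynomial.eval 0 g)⁻¹ * g, ?_, by ring⟩
    have := (MvPolynomial.mem_pow_idealOfVars_iff' 1 (1 - MvPolynomial.C (MvPolynomial.eval 0 g)⁻¹ * g)).2 (by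
      intro x hx
      have hx : x = 0 := by
        have : Finsupp.degree x = 0 := by omega
        exact (Finsupp.degree_eq_zero_iff x).1 this
      subst hx
      have : MvPolynomial.coeff 0 g = MvPolynomial.eval 0 g := by
        rw [MvPolynomial.eval_zero, MvPolynomial.constantCoeff_eq]
      rw [MvPolynomial.coeff_sub, MvPolynomial.coeff_C_mul, this, inv_mul_cancel₀ hg0]
      simp)
    simpa using this
  have hcop2 := hcop.pow_right (n := e + 1)
  rw [Ideal.isCoprime_iff_exists] at hcop2
  obtain ⟨a, ha, b, hb, hab⟩ := hcop2
  obtain ⟨a, rfl⟩ := Ideal.mem_span_singleton.1 ha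
  have : w v = a * (g * w v) + b * w v := by linear_combination - (w v) * hab
  rw [this]
  exact Ideal.add_mem _ (Ideal.mul_mem_left _ _ hgw) (Ideal.mul_mem_right _ _ hb)
end S7

namespace S7
open Asymptotics

lemma mult_poly {j : ℕ} (p : ContinuousMultilinearMap ℂ (fun _ : Fin j => (Fin 3 → ℂ)) ℂ) :
    ∃ T : P3, ∀ y : Fin 3 → ℂ, MvPolynomial.eval y T = p (fun _ => y) := by
  refine ⟨∑ K : Fin j → Fin 3, MvPolynomial.C (p (fun i => Pi.single (K i) 1)) *
    ∏ i, MvPolynomial.X (K i), fun y => ?_⟩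
  have h1 : (fun _ : Fin j => y) = fun _ : Fin j => ∑ a : Fin 3, y a • (Pi.single a (1:ℂ) : Fin 3 → ℂ) := by
    funext _
    ext b
    simp [Finset.sum_apply, Pi.single_apply]
  rw [h1, ContinuousMultilinearMap.map_sum]
  simp only [map_sum, map_mul, MvPolynomial.eval_C, map_prod, MvPolynomial.eval_X,
    ContinuousMultilinearMap.map_smul_univ, smul_eq_mul]
  exact Finset.sum_congr rfl fun K _ => mul_comm _ _

/-- substitution x ↦ x - q -/
noncomputable def shift (q : Fin 3 → ℂ) : P3 →+* P3 :=
  (MvPolynomial.aeval (fun i => (MvPolynomial.X i - MvPolynomial.C (q i) : P3))).toRingHom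

lemma eval_shift (q x : Fin 3 → ℂ) (p : P3) :
    MvPolynomial.eval x (shift q p) = MvPolynomial.eval (x - q) p := by
  have : (MvPolynomial.eval x).comp (shift q) = MvPolynomial.eval (x - q) := by
    apply MvPolynomial.ringHom_ext
    · intro r; simp [shift]
    · intro i; simp [shift]
  exact congrArg (fun f : P3 →+* ℂ => f p) this

lemma taylor (f : (Fin 3 → ℂ) → ℂ) (q : Fin 3 → ℂ) (hf : AnalyticAt ℂ f q) (k : ℕ) :
    ∃ T : P3, (fun x => f x - MvPolynomial.eval x T) =O[𝓝 q] (fun x => ‖x - q‖ ^ k) := by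
  obtain ⟨p, hp⟩ := hf
  have h1 := hp.isBigO_sub_partialSum_pow k
  choose T hT using fun j => mult_poly (p j)
  refine ⟨shift q (∑ j ∈ Finset.range k, T j), ?_⟩
  have ht : Tendsto (fun x : Fin 3 → ℂ => x - q) (𝓝 q) (𝓝 0) := by
    have : Continuous (fun x : Fin 3 → ℂ => x - q) := by fun_prop
    simpa using this.tendsto q
  have h2 := h1.comp_tendsto ht
  refine h2.congr_left fun x => ?_
  simp [eval_shift, FormalMultilinearSeries.partialSum, hT]

lemma hom_eval {p : P3} {k : ℕ} (hp : p.IsHomogeneous k) (t : ℂ) (z : Fin 3 → ℂ) :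
    MvPolynomial.eval (t • z) p = t ^ k * MvPolynomial.eval z p := by
  rw [MvPolynomial.eval_eq', MvPolynomial.eval_eq', Finset.mul_sum]
  refine Finset.sum_congr rfl fun d hd => ?_
  have h1 := hp (MvPolynomial.mem_support_iff.mp hd)
  have h2 : ∑ i, d i = k := by
    rw [← h1, Finsupp.weight_apply, Finsupp.sum_fintype _ _ (by simp)]; simp
  simp only [Pi.smul_apply, smul_eq_mul, mul_pow, Finset.prod_mul_distrib, Finset.prod_pow_eq_pow_sum, h2]
  ring

lemma line_poly (p : P3) (z : Fin 3 → ℂ) : ∃ P : Polynomial ℂ,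
    (∀ t, P.eval t = MvPolynomial.eval (t • z) p) ∧
    ∀ j, P.coeff j = MvPolynomial.eval z (MvPolynomial.homogeneousComponent j p) := by
  refine ⟨∑ i ∈ Finset.range (p.totalDegree + 1),
    Polynomial.C (MvPolynomial.eval z (MvPolynomial.homogeneousComponent i p)) * Polynomial.X ^ i,
    fun t => ?_, fun j => ?_⟩
  · conv_rhs => rw [← MvPolynomial.sum_homogeneousComponent p]
    simp only [Polynomial.eval_finsetSum, Polynomial.eval_mul, Polynomial.eval_C, Polynomial.eval_pow,
      Polynomial.eval_X, map_sum]
    refine Finset.sum_congr rfl fun i _ => ?_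
    have := (MvPolynomial.homogeneousComponent_isHomogeneous i p)
    rw [hom_eval this, mul_comm]
  · simp only [Polynomial.finsetSum_coeff, Polynomial.coeff_C_mul, Polynomial.coeff_X_pow]
    simp only [mul_ite, mul_one, mul_zero, Finset.sum_ite_eq, Finset.mem_range]
    split_ifs with h
    · rfl
    · rw [MvPolynomial.homogeneousComponent_eq_zero _ _ (by omega)]; simp

lemma poly_dvd (P : Polynomial ℂ) (k : ℕ) (h : (fun t => P.eval t) =O[𝓝[≠] (0:ℂ)] (fun t => ‖t‖ ^ k)) :
    (Polynomial.X : Polynomial ℂ) ^ k ∣ P := by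
  induction k generalizing P with
  | zero => simp
  | succ k ih =>
    have h0 : P.eval 0 = 0 := by
      have t1 : Tendsto (fun t : ℂ => ‖t‖ ^ (k+1)) (𝓝[≠] (0:ℂ)) (𝓝 0) := by
        have : Continuous (fun t : ℂ => ‖t‖ ^ (k+1)) := by fun_prop
        have := this.tendsto 0
        simp only [norm_zero, ne_eq, Nat.add_eq_zero_iff, one_ne_zero, and_false, not_false_eq_true, zero_pow] at this
        exact this.mono_left nhdsWithin_le_nhds
      have t2 := h.trans_tendsto t1
      have t3 : Tendsto (fun t : ℂ => P.eval t) (𝓝[≠] (0:ℂ)) (𝓝 (P.eval 0)) :=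
        (P.continuous.tendsto 0).mono_left nhdsWithin_le_nhds
      exact tendsto_nhds_unique t3 t2
    obtain ⟨Q, rfl⟩ := Polynomial.X_dvd_iff.mpr (by rw [Polynomial.coeff_zero_eq_eval_zero, h0] : P.coeff 0 = 0)
    rw [pow_succ']
    refine mul_dvd_mul_left _ (ih Q ?_)
    obtain ⟨c, hc⟩ := h.bound
    refine IsBigO.of_bound c ?_
    filter_upwards [hc, self_mem_nhdsWithin] with t ht ht0
    have hpos : 0 < ‖t‖ := norm_pos_iff.mpr ht0
    simp only [Polynomial.eval_mul, Polynomial.eval_X, norm_mul, pow_succ', norm_norm, norm_pow] at ht ⊢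
    refine le_of_mul_le_mul_left ?_ hpos
    linarith

lemma bigO_mem_zero (p : P3) (k : ℕ)
    (h : (fun x => MvPolynomial.eval x p) =O[𝓝 (0 : Fin 3 → ℂ)] (fun x => ‖x‖ ^ k)) : p ∈ m3 ^ k := by
  have h1 : ∀ j < k, MvPolynomial.homogeneousComponent j p = 0 := by
    intro j hj
    apply MvPolynomial.funext
    intro z
    obtain ⟨P, hP1, hP2⟩ := line_poly p z
    rw [← hP2, map_zero]
    have : (Polynomial.X : Polynomial ℂ) ^ k ∣ P := by
      apply poly_dvd
      have ht : Tendsto (fun t : ℂ => t • z) (𝓝[≠] 0) (𝓝 0) := by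
        have : Continuous (fun t : ℂ => t • z) := by fun_prop
        have := this.tendsto 0
        rw [zero_smul] at this
        exact this.mono_left nhdsWithin_le_nhds
      have h2 := h.comp_tendsto ht
      refine (h2.congr_left (fun t => (hP1 t).symm)).trans ?_
      refine IsBigO.of_bound (‖z‖ ^ k) (Eventually.of_forall fun t => ?_)
      simp [norm_smul, mul_pow, mul_comm]
    exact Polynomial.X_pow_dvd_iff.mp this j hj
  rw [MvPolynomial.mem_pow_idealOfVars_iff']
  intro d hd
  have := h1 _ hd
  have h3 := congrArg (MvPolynomial.coeff d) this
  rwa [MvPolynomial.coeff_homogeneousComponent, if_pos rfl] at h3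

lemma bigO_mem (p : P3) (q : Fin 3 → ℂ) (k : ℕ)
    (h : (fun x => MvPolynomial.eval x p) =O[𝓝 q] (fun x => ‖x - q‖ ^ k)) :
    p ∈ (RingHom.ker (MvPolynomial.eval q)) ^ k := by
  have h1 : shift (-q) p ∈ m3 ^ k := by
    apply bigO_mem_zero
    have ht : Tendsto (fun x : Fin 3 → ℂ => x + q) (𝓝 0) (𝓝 q) := by
      have : Continuous (fun x : Fin 3 → ℂ => x + q) := by fun_prop
      simpa using this.tendsto 0
    have h2 := h.comp_tendsto ht
    refine (h2.congr_left fun x => ?_).congr_right fun x => ?_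
    · simp [eval_shift]
    · simp
  have h2 : p = shift q (shift (-q) p) := by
    apply MvPolynomial.funext; intro x; simp [eval_shift]
  rw [h2]
  have h3 := Ideal.mem_map_of_mem (shift q) h1
  rw [Ideal.map_pow] at h3
  refine Ideal.pow_right_mono ?_ k h3
  rw [Ideal.map_le_iff_le_comap]
  intro f hf
  have h4 : MvPolynomial.eval 0 f = 0 := by
    have : m3 ≤ RingHom.ker (MvPolynomial.eval (0 : Fin 3 → ℂ)) := by
      rw [m3, MvPolynomial.idealOfVars, Ideal.span_le]
      rintro _ ⟨i, rfl⟩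
      simp
    exact this hf
  rw [Ideal.mem_comap, RingHom.mem_ker, eval_shift, sub_self, h4]

lemma hom_analytic (f : (Fin 3 → ℂ) → ℂ) (k : ℕ) (hf : AnalyticAt ℂ f 0)
    (hh : ∀ (t : ℂ) z, f (t • z) = t ^ k * f z) :
    ∃ p : P3, p.IsHomogeneous k ∧ ∀ z, MvPolynomial.eval z p = f z := by
  obtain ⟨T, hT⟩ := taylor f 0 hf (k+1)
  refine ⟨MvPolynomial.homogeneousComponent k T, MvPolynomial.homogeneousComponent_isHomogeneous k T, fun z => ?_⟩
  obtain ⟨P, hP1, hP2⟩ := line_poly T z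
  have : (Polynomial.X : Polynomial ℂ) ^ (k+1) ∣ Polynomial.C (f z) * Polynomial.X ^ k - P := by
    apply poly_dvd
    have ht : Tendsto (fun t : ℂ => t • z) (𝓝[≠] 0) (𝓝 0) := by
      have : Continuous (fun t : ℂ => t • z) := by fun_prop
      have := this.tendsto 0
      rw [zero_smul] at this
      exact this.mono_left nhdsWithin_le_nhds
    have h2 := hT.comp_tendsto ht
    refine (h2.congr_left (fun t => ?_)).trans ?_
    · simp only [Function.comp_apply, hP1, hh, Polynomial.eval_sub, Polynomial.eval_mul, Polynomial.eval_C, Polynomial.eval_pow, Polynomial.eval_X]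
      ring
    · refine IsBigO.of_bound (‖z‖ ^ (k+1)) (Eventually.of_forall fun t => ?_)
      simp [norm_smul, mul_pow, mul_comm]
  have h3 := Polynomial.X_pow_dvd_iff.mp this k (Nat.lt_succ_self k)
  rw [← hP2]
  simp only [Polynomial.coeff_sub, Polynomial.coeff_C_mul, Polynomial.coeff_X_pow, if_pos, mul_one] at h3
  exact (sub_eq_zero.mp h3).symm

lemma lift_form {N m : ℕ} (φ : (Fin 3 → ℂ) → ((Fin N → ℂ) [⋀^Fin m]→ₗ[ℂ] ℂ))
    (h : ∀ v, ∃ p : P3, ∀ x, MvPolynomial.eval x p = φ x v) :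
    ∃ Φ : (Fin N → P3) [⋀^Fin m]→ₗ[P3] P3, ∀ x u,
      MvPolynomial.eval x (Φ u) = φ x (fun i j => MvPolynomial.eval x (u i j)) := by
  have key : ∀ u : Fin m → Fin N → P3, ∃ p : P3, ∀ x,
      MvPolynomial.eval x p = φ x (fun i j => MvPolynomial.eval x (u i j)) := by
    intro u
    choose p hp using h
    refine ⟨∑ K : Fin m → Fin N, (∏ i, u i (K i)) * p (fun i => Pi.single (K i) 1), fun x => ?_⟩
    have h1 : (fun i j => MvPolynomial.eval x (u i j)) =
        fun i : Fin m => ∑ a : Fin N, (MvPolynomial.eval x (u i a)) • (Pi.single a (1:ℂ) : Fin N → ℂ) := by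
      funext i
      ext b
      simp [Finset.sum_apply, Pi.single_apply]
    rw [h1]
    have := (φ x).toMultilinearMap.map_sum (fun (i : Fin m) (a : Fin N) => (MvPolynomial.eval x (u i a)) • (Pi.single a (1:ℂ) : Fin N → ℂ))
    simp only [AlternatingMap.coe_multilinearMap] at this
    rw [this]
    simp only [map_sum, map_mul, map_prod, hp]
    refine Finset.sum_congr rfl fun K _ => ?_
    have := (φ x).toMultilinearMap.map_smul_univ (fun i => MvPolynomial.eval x (u i (K i))) (fun i => (Pi.single (K i) (1:ℂ) : Fin N → ℂ))
    simp only [AlternatingMap.coe_multilinearMap] at this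
    rw [this, smul_eq_mul]
  choose F hF using key
  have upd : ∀ (x : Fin 3 → ℂ) (u : Fin m → Fin N → P3) (i : Fin m) (y : Fin N → P3),
      (fun a b => MvPolynomial.eval x (Function.update u i y a b)) =
      Function.update (fun a b => MvPolynomial.eval x (u a b)) i (fun b => MvPolynomial.eval x (y b)) := by
    intro x u i y
    funext a
    by_cases ha : a = i
    · subst ha; simp
    · simp [ha]
  refine ⟨{ toFun := F, map_update_add' := ?_, map_update_smul' := ?_, map_eq_zero_of_eq' := ?_ }, fun x u => hF u x⟩
  · intro inst u i y z
    rw [Subsingleton.elim inst (instDecidableEqFin m)]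
    apply MvPolynomial.funext
    intro x
    simp only [map_add, hF, upd]
    rw [← AlternatingMap.map_update_add]
    congr 1
    congr 1
    ext b; simp
  · intro inst u i c y
    rw [Subsingleton.elim inst (instDecidableEqFin m)]
    apply MvPolynomial.funext
    intro x
    simp only [hF, upd, smul_eq_mul, map_mul]
    rw [← smul_eq_mul, ← AlternatingMap.map_update_smul]
    congr 1
    congr 1
    ext b; simp
  · intro u i j hij hne
    apply MvPolynomial.funext
    intro x
    rw [hF, map_zero]
    exact (φ x).map_eq_zero_of_eq _ (by rw [hij]) hne

lemma approx_form {N m : ℕ} (q : Fin 3 → ℂ) (Θ : (Fin 3 → ℂ) → ((Fin N → ℂ) [⋀^Fin m]→ₗ[ℂ] ℂ))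
    (h : ∀ v, AnalyticAt ℂ (fun x => Θ x v) q) (k : ℕ) :
    ∃ T : (Fin N → P3) [⋀^Fin m]→ₗ[P3] P3, ∀ u : Fin m → Fin N → P3,
      (fun x => Θ x (fun i j => MvPolynomial.eval x (u i j)) - MvPolynomial.eval x (T u))
        =O[𝓝 q] (fun x => ‖x - q‖ ^ k) := by
  classical
  let ev : ((Fin N → ℂ) [⋀^Fin m]→ₗ[ℂ] ℂ) →ₗ[ℂ] ((Fin m → Fin N) → ℂ) :=
    { toFun := fun w K => w (fun i => Pi.single (K i) 1)
      map_add' := fun a b => rfl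
      map_smul' := fun a b => rfl }
  have hinj : LinearMap.ker ev = ⊥ := by
    rw [LinearMap.ker_eq_bot]
    intro a b hab
    refine Module.Basis.ext_alternating (Pi.basisFun ℂ (Fin N)) fun K _ => ?_
    have := congrFun hab K
    simpa [ev] using this
  obtain ⟨L, hL⟩ := LinearMap.exists_leftInverse_of_injective ev hinj
  choose T hT using fun K : Fin m → Fin N => taylor _ q (h (fun i => Pi.single (K i) 1)) k
  choose Ψ hΨ using fun K : Fin m → Fin N =>
    lift_form (fun _ : Fin 3 → ℂ => L (Pi.single K 1))
      (fun v => ⟨MvPolynomial.C (L (Pi.single K 1) v), fun x => by simp⟩)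
  refine ⟨∑ K, T K • Ψ K, fun u => ?_⟩
  have e1 : ∀ x, Θ x (fun i j => MvPolynomial.eval x (u i j)) =
      ∑ K : Fin m → Fin N, Θ x (fun i => Pi.single (K i) 1) * MvPolynomial.eval x (Ψ K u) := by
    intro x
    have h1 : Θ x = ∑ K : Fin m → Fin N, Θ x (fun i => Pi.single (K i) 1) • L (Pi.single K 1) := by
      have h2 : L (ev (Θ x)) = Θ x := congrArg (fun f => f (Θ x)) hL
      conv_lhs => rw [← h2]
      have h3 : ev (Θ x) = ∑ K : Fin m → Fin N, Θ x (fun i => Pi.single (K i) 1) • (Pi.single K 1 : (Fin m → Fin N) → ℂ) := by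
        funext K
        simp [Finset.sum_apply, Pi.single_apply, ev]
      rw [h3, map_sum]
      simp only [map_smul]
    conv_lhs => rw [h1]
    rw [alt_sum_apply]
    simp only [AlternatingMap.smul_apply, smul_eq_mul, hΨ]
  have e2 : ∀ x, Θ x (fun i j => MvPolynomial.eval x (u i j)) - MvPolynomial.eval x ((∑ K, T K • Ψ K) u) =
      ∑ K : Fin m → Fin N, (Θ x (fun i => Pi.single (K i) 1) - MvPolynomial.eval x (T K)) * MvPolynomial.eval x (Ψ K u) := by
    intro x
    rw [e1, alt_sum_apply]
    simp only [AlternatingMap.smul_apply, smul_eq_mul, map_sum, map_mul, sub_mul, Finset.sum_sub_distrib]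
  simp only [e2]
  refine IsBigO.fun_sum fun K _ => ?_
  have hb : (fun x => MvPolynomial.eval x (Ψ K u)) =O[𝓝 q] (fun _ => (1:ℝ)) :=
    ((MvPolynomial.continuous_eval (Ψ K u)).tendsto q).isBigO_one ℝ
  simpa using (hT K).mul hb

lemma krull {N m : ℕ} (V R : Fin N → P3) (w : (Fin N → P3) [⋀^Fin m]→ₗ[P3] P3) (q : Fin 3 → ℂ)
    (Θ : (Fin 3 → ℂ) → ((Fin N → ℂ) [⋀^Fin (m+2)]→ₗ[ℂ] ℂ))
    (hΘ : ∀ v, AnalyticAt ℂ (fun x => Θ x v) q)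
    (h : ∀ᶠ x in 𝓝 q, ∀ u : Fin m → Fin N → P3, MvPolynomial.eval x (w u) =
      Θ x (Fin.cons (fun j => MvPolynomial.eval x (V j)) (Fin.cons (fun j => MvPolynomial.eval x (R j))
        (fun i j => MvPolynomial.eval x (u i j))))) :
    ∃ f ∈ dIdeal V R w, MvPolynomial.eval q f ≠ 0 := by
  classical
  let ev : ((Fin N → P3) [⋀^Fin m]→ₗ[P3] P3) →ₗ[P3] ((Fin m → Fin N) → P3) :=
    { toFun := fun w K => w (fun i => Pi.single (K i) 1)
      map_add' := fun a b => rfl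
      map_smul' := fun a b => rfl }
  have hinj : Function.Injective ev := by
    intro a b hab
    refine Module.Basis.ext_alternating (Pi.basisFun P3 (Fin N)) fun K _ => ?_
    have := congrFun hab K
    simpa [ev] using this
  let Im : Submodule P3 ((Fin m → Fin N) → P3) := LinearMap.range (ev ∘ₗ con R ∘ₗ con V)
  let I : Ideal P3 := RingHom.ker (MvPolynomial.eval q)
  have hmem : Im.mkQ (ev w) ∈ (⨅ k : ℕ, I ^ k • (⊤ : Submodule P3 (((Fin m → Fin N) → P3) ⧸ Im))) := by
    rw [Submodule.mem_iInf]
    intro k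
    obtain ⟨T, hT⟩ := approx_form q Θ hΘ k
    have h1 : Im.mkQ (ev w) = Im.mkQ (ev w - ev (con R (con V T))) := by
      rw [map_sub]
      have : Im.mkQ (ev (con R (con V T))) = 0 := by
        rw [Submodule.mkQ_apply, Submodule.Quotient.mk_eq_zero]
        exact ⟨T, rfl⟩
      rw [this, sub_zero]
    have h2 : ∀ K, (ev w - ev (con R (con V T))) K ∈ I ^ k := by
      intro K
      apply bigO_mem
      have := hT (Fin.cons V (Fin.cons R (fun i => Pi.single (K i) 1)))
      refine this.congr' ?_ EventuallyEq.rfl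
      filter_upwards [h] with x hx
      have h3 := hx (fun i => Pi.single (K i) 1)
      simp only [Pi.sub_apply, map_sub]
      change _ - _ = MvPolynomial.eval x (w (fun i => Pi.single (K i) 1)) - MvPolynomial.eval x (T (Fin.cons V (Fin.cons R (fun i => Pi.single (K i) 1))))
      rw [h3]
      congr 2
      funext i
      refine Fin.cases rfl (fun i => ?_) i
      refine Fin.cases rfl (fun i => ?_) i
      rfl
    rw [h1, pi_eq_sum_univ' (ev w - ev (con R (con V T))), map_sum]
    refine Submodule.sum_mem _ fun K _ => ?_
    rw [map_smul]
    exact Submodule.smul_mem_smul (h2 K) trivial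
  rw [Ideal.mem_iInf_smul_pow_eq_bot_iff] at hmem
  obtain ⟨⟨r, hr⟩, hrw⟩ := hmem
  refine ⟨1 - r, ?_, ?_⟩
  · have h1 : Im.mkQ ((1 - r) • ev w) = 0 := by
      rw [map_smul, sub_smul, one_smul]
      exact sub_eq_zero.mpr hrw.symm
    rw [Submodule.mkQ_apply, Submodule.Quotient.mk_eq_zero] at h1
    obtain ⟨T, hT⟩ := h1
    refine ⟨T, hinj ?_⟩
    rw [map_smul]
    exact hT.symm
  · have : MvPolynomial.eval q r = 0 := hr
    simp [this]

end S7

namespace S7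

lemma exists_proj {M : ℕ} (p : Fin (M+1) → ℂ) (hp : p ≠ 0) :
    ∃ π : (Fin (M+1) → ℂ) →ₗ[ℂ] (Fin M → ℂ), Function.Surjective π ∧ π p = 0 := by
  have h1 : Module.finrank ℂ ((Fin (M+1) → ℂ) ⧸ Submodule.span ℂ {p}) = Module.finrank ℂ (Fin M → ℂ) := by
    have := Submodule.finrank_quotient_add_finrank (Submodule.span ℂ {p})
    rw [finrank_span_singleton hp] at this
    simp at this ⊢
    omega
  let e := LinearEquiv.ofFinrankEq _ _ h1
  refine ⟨e.toLinearMap ∘ₗ (Submodule.span ℂ {p}).mkQ, ?_, ?_⟩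
  · exact e.surjective.comp (Submodule.mkQ_surjective _)
  · simp only [LinearMap.comp_apply, Submodule.mkQ_apply]
    rw [(Submodule.Quotient.mk_eq_zero _).mpr (Submodule.mem_span_singleton_self p), map_zero]

lemma exists_not_mem {M : ℕ} (Z : Set (Fin M → ℂ)) (h : dimH Z < ((2 * M : ℕ) : ℝ≥0∞)) : ∃ p, p ∉ Z := by
  by_contra! hc
  have : Z = univ := eq_univ_of_forall hc
  rw [this, Real.dimH_univ_eq_finrank] at h
  have : Module.finrank ℝ (Fin M → ℂ) = 2 * M := by
    rw [Module.finrank_pi_fintype]; simp [mul_comm]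
  rw [this] at h
  exact lt_irrefl _ h

lemma dimH_img {M M' : ℕ} (π : (Fin M → ℂ) →ₗ[ℂ] (Fin M' → ℂ)) (Z : Set (Fin M → ℂ)) :
    dimH (π '' Z) ≤ dimH Z := by
  have := π.toContinuousLinearMap.lipschitz.dimH_image_le Z
  simpa using this

/-- the three-dimensional linear embedding -/
noncomputable def iot {N : ℕ} (p1 p2 p3 : Fin N → ℂ) (q : Fin 3 → ℂ) : Fin N → ℂ :=
  q 0 • p1 + q 1 • p2 + q 2 • p3

lemma flag {m N : ℕ} (hN : N = m + 3) (Z1 Z2 : Set (Fin N → ℂ)) (h21 : Z2 ⊆ Z1) (h0 : 0 ∈ Z2)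
    (c1 : ∀ (c : ℂ) z, c ≠ 0 → z ∈ Z1 → c • z ∈ Z1) (c2 : ∀ (c : ℂ) z, c ≠ 0 → z ∈ Z2 → c • z ∈ Z2)
    (d1 : dimH Z1 < ((2 * (m+2) : ℕ) : ℝ≥0∞)) (d2 : dimH Z2 < ((2 * (m+1) : ℕ) : ℝ≥0∞))
    (p1 : Fin N → ℂ) (hp1 : p1 ∉ Z1) :
    ∃ p2 p3, ∀ q : Fin 3 → ℂ, q ≠ 0 → iot p1 p2 p3 q ∉ Z2 ∧ (q 2 = 0 → iot p1 p2 p3 q ∉ Z1) := by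
  subst hN
  have hp10 : p1 ≠ 0 := fun h => hp1 (h ▸ h21 h0)
  obtain ⟨π1, s1, k1⟩ := exists_proj p1 hp10
  obtain ⟨p2', hp2'⟩ := exists_not_mem (π1 '' Z1) ((dimH_img _ _).trans_lt d1)
  obtain ⟨p2, rfl⟩ := s1 p2'
  have hp20 : π1 p2 ≠ 0 := fun h => hp2' (h ▸ ⟨0, h21 h0, by simp⟩)
  obtain ⟨π2, s2, k2⟩ := exists_proj (π1 p2) hp20
  obtain ⟨p3', hp3'⟩ := exists_not_mem ((π2 ∘ₗ π1) '' Z2) ((dimH_img _ _).trans_lt d2)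
  obtain ⟨p3, rfl⟩ := (s2.comp s1) p3'
  have hz : ∀ q : Fin 3 → ℂ, q ≠ 0 → q 2 = 0 → iot p1 p2 p3 q ∉ Z1 := by
    intro q hq hq2 hmem
    by_cases hq1 : q 1 = 0
    · have hq0 : q 0 ≠ 0 := by
        intro h
        apply hq
        ext i; fin_cases i <;> simp [h, hq1, hq2]
      have := c1 (q 0)⁻¹ _ (inv_ne_zero hq0) hmem
      simp [iot, hq1, hq2, smul_smul, inv_mul_cancel₀ hq0] at this
      exact hp1 this
    · refine hp2' ⟨(q 1)⁻¹ • iot p1 p2 p3 q, c1 _ _ (inv_ne_zero hq1) hmem, ?_⟩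
      simp [iot, hq2, k1, smul_smul, inv_mul_cancel₀ hq1]
  refine ⟨p2, p3, fun q hq => ⟨fun hmem => ?_, hz q hq⟩⟩
  by_cases hq2 : q 2 = 0
  · exact hz q hq hq2 (h21 hmem)
  · refine hp3' ⟨(q 2)⁻¹ • iot p1 p2 p3 q, c2 _ _ (inv_ne_zero hq2) hmem, ?_⟩
    simp [iot, k1, k2, smul_smul, inv_mul_cancel₀ hq2]

lemma exists_minor {N : ℕ} (V z : Fin N → ℂ) (hz : z ≠ 0) (hV : V ∉ Submodule.span ℂ {z}) :
    ∃ i j, V i * z j - V j * z i ≠ 0 := by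
  by_contra! hc
  apply hV
  obtain ⟨j, hj⟩ := Function.ne_iff.mp hz
  have hj : z j ≠ 0 := hj
  rw [Submodule.mem_span_singleton]
  refine ⟨V j / z j, ?_⟩
  ext i
  have := hc i j
  simp only [Pi.smul_apply, smul_eq_mul]
  field_simp
  linear_combination -this

lemma hom_zero {p : P3} {k e : ℕ} (hp : p.IsHomogeneous k) (hm : p ∈ m3 ^ e) (h : k < e) : p = 0 := by
  ext d
  rw [MvPolynomial.mem_pow_idealOfVars_iff'] at hm
  by_contra hd
  have h1 := hp hd
  have h2 := hm d
  have h3 : Finsupp.degree d = k := by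
    rw [← h1, Finsupp.degree_eq_weight_one]; rfl
  exact hd (h2 (by omega))

lemma hom_mem {p : P3} {k : ℕ} (hp : p.IsHomogeneous k) : p ∈ m3 ^ k := by
  rw [MvPolynomial.mem_pow_idealOfVars_iff']
  intro d hd
  by_contra hd'
  have h1 := hp hd'
  have h3 : Finsupp.degree d = k := by
    rw [← h1, Finsupp.degree_eq_weight_one]; rfl
  omega

lemma iot_analytic {N : ℕ} (p1 p2 p3 : Fin N → ℂ) (q : Fin 3 → ℂ) :
    AnalyticAt ℂ (iot p1 p2 p3) q := by
  have : iot p1 p2 p3 = (LinearMap.toContinuousLinearMap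
    ({ toFun := iot p1 p2 p3
       map_add' := fun a b => by simp only [iot, Pi.add_apply, add_smul]; abel
       map_smul' := fun c a => by simp [iot, smul_smul] } : (Fin 3 → ℂ) →ₗ[ℂ] (Fin N → ℂ))) := rfl
  rw [this]
  exact ContinuousLinearMap.analyticAt _ _

lemma mainlem {N m d e : ℕ} (hN : N = m + 3) (hm : 0 < m)
    (ω : (Fin N → ℂ) → ((Fin N → ℂ) [⋀^Fin m]→ₗ[ℂ] ℂ)) (V : (Fin N → ℂ) → (Fin N → ℂ))
    (hω : ∀ v, AnalyticOnNhd ℂ (fun z => ω z v) univ)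
    (hω' : ∀ (t : ℂ) z v, ω (t • z) v = t ^ (d+1) * ω z v)
    (hV : AnalyticOnNhd ℂ V univ) (hV' : ∀ (t : ℂ) z, V (t • z) = t ^ e • V z)
    (htan : ∀ z v i, v i = V z → ω z v = 0) (hrad : ∀ z v i, v i = z → ω z v = 0)
    (p1 p2 p3 : Fin N → ℂ) (hp1 : ω p1 ≠ 0)
    (H1 : ∀ q : Fin 3 → ℂ, q ≠ 0 →
      (∃ Θ : (Fin N → ℂ) → ((Fin N → ℂ) [⋀^Fin (m+2)]→ₗ[ℂ] ℂ),
        (∀ v, AnalyticAt ℂ (fun z => Θ z v) (iot p1 p2 p3 q)) ∧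
        ∀ᶠ z in 𝓝 (iot p1 p2 p3 q), ∀ v, ω z v = Θ z (Fin.cons (V z) (Fin.cons z v))) ∨
      (iot p1 p2 p3 q ≠ 0 ∧ V (iot p1 p2 p3 q) ∉ Submodule.span ℂ {iot p1 p2 p3 q}))
    (H2 : ∀ q : Fin 3 → ℂ, q ≠ 0 → q 2 = 0 →
      (iot p1 p2 p3 q ≠ 0 ∧ V (iot p1 p2 p3 q) ∉ Submodule.span ℂ {iot p1 p2 p3 q})) : e ≤ d := by
  subst hN
  by_contra! hlt
  have ism : ∀ (t : ℂ) x, iot p1 p2 p3 (t • x) = t • iot p1 p2 p3 x := by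
    intro t x; simp [iot, smul_smul]
  have hωp : ∀ v, ∃ p : P3, p.IsHomogeneous (d+1) ∧ ∀ x, MvPolynomial.eval x p = ω (iot p1 p2 p3 x) v := by
    intro v
    refine hom_analytic (fun x => ω (iot p1 p2 p3 x) v) (d+1) ?_ ?_
    · exact AnalyticAt.fun_comp (hω v _ trivial) (iot_analytic p1 p2 p3 0)
    · intro t z; rw [ism, hω']
  obtain ⟨w, hw⟩ := lift_form (fun x => ω (iot p1 p2 p3 x)) (fun v => ⟨_, (hωp v).choose_spec.2⟩)
  have hVp : ∀ i, ∃ p : P3, p.IsHomogeneous e ∧ ∀ x, MvPolynomial.eval x p = V (iot p1 p2 p3 x) i := by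
    intro i
    refine hom_analytic (fun x => V (iot p1 p2 p3 x) i) e ?_ ?_
    · have h1 : AnalyticAt ℂ (fun x => V (iot p1 p2 p3 x)) 0 :=
        AnalyticAt.fun_comp (hV _ trivial) (iot_analytic p1 p2 p3 0)
      exact (analyticAt_pi_iff.mp h1) i
    · intro t z; rw [ism, hV']; rfl
  choose V' hVh hVe using hVp
  let R' : Fin (m+3) → P3 := fun j => MvPolynomial.X 0 * MvPolynomial.C (p1 j) +
    MvPolynomial.X 1 * MvPolynomial.C (p2 j) + MvPolynomial.X 2 * MvPolynomial.C (p3 j)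
  have hRe : ∀ j x, MvPolynomial.eval x (R' j) = iot p1 p2 p3 x j := by
    intro j x; simp [R', iot]
  have hVf : ∀ x, (fun j => MvPolynomial.eval x (V' j)) = V (iot p1 p2 p3 x) := fun x => funext fun j => hVe j x
  have hRf : ∀ x, (fun j => MvPolynomial.eval x (R' j)) = iot p1 p2 p3 x := fun x => funext fun j => hRe j x
  have hRm : ∀ j, R' j ∈ m3 := by
    intro j
    have hX : ∀ i : Fin 3, (MvPolynomial.X i : P3) ∈ m3 := fun i => Ideal.subset_span ⟨i, rfl⟩
    exact Ideal.add_mem _ (Ideal.add_mem _ (Ideal.mul_mem_right _ _ (hX 0)) (Ideal.mul_mem_right _ _ (hX 1)))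
      (Ideal.mul_mem_right _ _ (hX 2))
  have minor : ∀ q : Fin 3 → ℂ, (iot p1 p2 p3 q ≠ 0 ∧ V (iot p1 p2 p3 q) ∉ Submodule.span ℂ {iot p1 p2 p3 q}) →
      ∃ i j, MvPolynomial.eval q (V' i * R' j - V' j * R' i) ≠ 0 := by
    rintro q ⟨h1, h2⟩
    obtain ⟨i, j, hij⟩ := exists_minor _ _ h1 h2
    refine ⟨i, j, ?_⟩
    simpa only [map_sub, map_mul, hVe, hRe] using hij
  have key := core (e := e) V' R' w ?_ ?_ (fun i => hom_mem (hVh i)) hRm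
  · apply hp1
    ext v
    have h1 := key (fun i j => MvPolynomial.C (v i j))
    obtain ⟨p, hp, hpe⟩ := hωp v
    have h2 : w (fun i j => MvPolynomial.C (v i j)) = p := by
      apply MvPolynomial.funext; intro x
      rw [hw, hpe]; simp
    rw [h2] at h1
    have h3 := hom_zero hp h1 (by omega)
    have h4 := hpe ![1, 0, 0]
    rw [h3] at h4
    simp [iot] at h4
    simpa using h4.symm
  · intro q hq
    rcases H1 q hq with ⟨Θ, hΘ, hdiv⟩ | hns
    · refine krull V' R' w q (fun x => Θ (iot p1 p2 p3 x)) ?_ ?_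
      · intro v
        exact AnalyticAt.fun_comp (hΘ v) (iot_analytic p1 p2 p3 q)
      · have := (iot_analytic p1 p2 p3 q).continuousAt.eventually hdiv
        filter_upwards [this] with x hx u
        rw [hw, hx, hVf, hRf]
    · obtain ⟨i, j, hij⟩ := minor q hns
      refine ⟨_, ?_, hij⟩
      obtain ⟨r, rfl⟩ : ∃ r, m = r + 1 := ⟨m - 1, by omega⟩
      have c1 : con V' w = 0 := by
        refine AlternatingMap.ext fun v => ?_
        apply MvPolynomial.funext; intro x
        rw [con_apply, hw]
        simp only [AlternatingMap.zero_apply, map_zero]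
        exact htan _ _ 0 (hVf x)
      have c2 : con R' w = 0 := by
        refine AlternatingMap.ext fun v => ?_
        apply MvPolynomial.funext; intro x
        rw [con_apply, hw]
        simp only [AlternatingMap.zero_apply, map_zero]
        exact hrad _ _ 0 (hRf x)
      exact ⟨_, (F3 V' R' w c1 c2 i j).symm⟩
  · intro q hq hq2
    obtain ⟨i, j, hij⟩ := minor q (H2 q hq hq2)
    exact ⟨_, Ideal.subset_span ⟨(i, j), rfl⟩, hij⟩
end S7

namespace S7

lemma codim_dim {N c : ℕ} {Z : Set (Cn N)} (h : CodimGE N Z c) : dimH Z ≤ ((2 * (N - c) : ℕ) : ℝ≥0∞) := by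
  rcases h with h | h
  · rw [h, dimH_empty]; exact zero_le
  · have h1 : dimH Z + ((2 * c : ℕ) : ℝ≥0∞) ≤ ((2 * (N - c) + 2 * c : ℕ) : ℝ≥0∞) := by
      have h2 : ((2 * N : ℕ) : ℝ≥0∞) ≤ ((2 * (N - c) + 2 * c : ℕ) : ℝ≥0∞) := by
        exact_mod_cast (by omega)
      refine le_trans ?_ h2
      exact_mod_cast h
    rw [Nat.cast_add] at h1
    exact (ENNReal.add_le_add_iff_right (ENNReal.natCast_ne_top _)).mp h1

lemma cone_scale {n : ℕ} (G : ProjFol1 n) (c : ℂ) (z : Cn (n+1)) (hc : c ≠ 0)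
    (hz : z ∈ insert 0 G.coneSing) : c • z ∈ insert 0 G.coneSing := by
  rcases hz with rfl | ⟨h1, h2⟩
  · left; simp
  · right
    refine ⟨smul_ne_zero hc h1, ?_⟩
    rw [G.homog]
    apply Submodule.smul_mem
    have : Submodule.span ℂ {c • z} = Submodule.span ℂ {z} :=
      Submodule.span_singleton_smul_eq (IsUnit.mk0 c hc) z
    rw [this]
    exact h2

lemma not_cone {n : ℕ} (G : ProjFol1 n) (z : Cn (n+1)) (hz : z ∉ insert 0 G.coneSing) :
    z ≠ 0 ∧ G.V z ∉ Submodule.span ℂ {z} := by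
  have h0 : z ≠ 0 := fun h => hz (Or.inl h)
  exact ⟨h0, fun h => hz (Or.inr ⟨h0, h⟩)⟩

lemma dimH_insert0 {N : ℕ} (Z : Set (Fin N → ℂ)) : dimH (insert 0 Z) = dimH Z := by
  rw [Set.insert_eq, dimH_union, dimH_singleton]; simp

lemma cast_lt {a b : ℕ} {x : ℝ≥0∞} (h : x ≤ (a : ℝ≥0∞)) (hab : a < b) : x < (b : ℝ≥0∞) :=
  h.trans_lt (by exact_mod_cast hab)

end S7


/-- Corollary 3.8: Let `D` be a two-dimensional distribution on `ℙⁿ`,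
`n ≥ 3`, and `G` a one-dimensional foliation tangent to `D`. If `G` locally divides `D`
then `deg G ≤ deg D`. In particular, if `codim sing G ≥ 3` then `deg G ≤ deg D`. -/
theorem statement_7 (n : ℕ) (hn : 3 ≤ n) (D : ProjDist n 2) (G : ProjFol1 n)
    (htan : PTangent G D) :
    ((∀ q : Cn (n + 1), q ≠ 0 → PLocDividesAt G D q) → G.d ≤ D.d) ∧
    (CodimGE (n + 1) G.coneSing 3 → G.d ≤ D.d) := by
  have hn' : n + 1 = (n - 2) + 3 := by omega
  have dZ : dimH (insert 0 G.coneSing) ≤ ((2 * (n + 1 - 2) : ℕ) : ℝ≥0∞) := by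
    rw [S7.dimH_insert0]; exact S7.codim_dim G.codim
  have dW := S7.codim_dim D.codim
  obtain ⟨p1, hp1⟩ := S7.exists_not_mem (insert 0 G.coneSing ∪ {z | z ≠ 0 ∧ D.ω z = 0}) (by
    rw [dimH_union]
    exact S7.cast_lt (max_le dZ dW) (by omega))
  have hp1Z : p1 ∉ insert 0 G.coneSing := fun h => hp1 (Or.inl h)
  have hp1w : D.ω p1 ≠ 0 := fun h => hp1 (Or.inr ⟨fun h0 => hp1Z (Or.inl h0), h⟩)
  constructor
  · intro hdiv
    obtain ⟨p2, p3, hf⟩ := S7.flag (m := n - 2) hn' (insert 0 G.coneSing) {0}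
      (by rintro _ rfl; exact Or.inl rfl) rfl (S7.cone_scale G)
      (by rintro c _ _ rfl; simp) (S7.cast_lt dZ (by omega))
      (by rw [dimH_singleton]; exact_mod_cast (by omega)) p1 hp1Z
    refine S7.mainlem (m := n - 2) hn' (by omega) D.ω G.V D.hol D.homog G.hol G.homog htan D.radial
      p1 p2 p3 hp1w (fun q hq => Or.inl ?_) (fun q hq hq2 => S7.not_cone G _ ((hf q hq).2 hq2))
    exact hdiv _ (hf q hq).1
  · intro hc
    have dZ' : dimH (insert 0 G.coneSing) ≤ ((2 * (n + 1 - 3) : ℕ) : ℝ≥0∞) := by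
      rw [S7.dimH_insert0]; exact S7.codim_dim hc
    obtain ⟨p2, p3, hf⟩ := S7.flag (m := n - 2) hn' (insert 0 G.coneSing) (insert 0 G.coneSing)
      subset_rfl (Or.inl rfl) (S7.cone_scale G) (S7.cone_scale G) (S7.cast_lt dZ (by omega))
      (S7.cast_lt dZ' (by omega)) p1 hp1Z
    exact S7.mainlem (m := n - 2) hn' (by omega) D.ω G.V D.hol D.homog G.hol G.homog htan D.radial
      p1 p2 p3 hp1w (fun q hq => Or.inr (S7.not_cone G _ (hf q hq).1))
      (fun q hq hq2 => S7.not_cone G _ ((hf q hq).2 hq2))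
end
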